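/- Let p and r be distinct primes with p ≡ 1 (mod 4) and r odd, and let c, k, m, q, t be positive integers with m = 4t, q = p^m, c = (q−1)/4 and k = (4/r)·Ψ_r(q). Assume q ≡ 1 (mod r), gcd(4, r) = 1, and that c is a primitive divisor of p^m − 1. Let A and B be the (unique up to the sign of B) integers satisfying √q = p^{2t} = A² + 4B², A ≡ 1 (mod 4) and gcd(A, p) = 1. Then the weights occurring among codewords of C(k, q^r) are exactly the numbers w_{ℓ1,ℓ2,ℓ3,ℓ4} = ((p−1)/(4p))·( h·q + (ℓ1+ℓ2−ℓ3−ℓ4)·√q + ( 2A(ℓ1−ℓ2) + 4B(ℓ3−ℓ4) )·p^t ), over all 4-tuples (ℓ1, ℓ2, ℓ3, ℓ4) of non-negative integers with h = ℓ1+ℓ2+ℓ3+ℓ4 satisfying 0 ≤ h ≤ r, and for every integer w the number of codewords of C(k, q^r) of weight w equals the sum, over all such tuples with w_{ℓ1,ℓ2,ℓ3,ℓ4} = w, of binom(r,h)·(h!/(ℓ1! ℓ2! ℓ3! ℓ4!))·c^h. -/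

import Mathlib

open scoped BigOperators

/-- `Ψ_b(x) = x^(b-1) + ⋯ + x + 1`. -/
def psi (b x : ℕ) : ℕ := ∑ i ∈ Finset.range b, x ^ i

/-- `n` is a primitive divisor of `p^m - 1`. -/
def IsPrimitiveDivisor (n p m : ℕ) : Prop :=
  n ∣ p ^ m - 1 ∧ ∀ t : ℕ, 1 ≤ t → t < m → ¬ n ∣ p ^ t - 1

/-- The codeword `c_γ` of the irreducible cyclic code `C(k,q)` of length `n`;
its `i`-th coordinate is `Tr_{q/p}(γ ω^(k i))`. -/
noncomputable def cycWord (p : ℕ) (F : Type) [Field F] [Fintype F] [Algebra (ZMod p) F]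
    (ω : F) (k n : ℕ) (γ : F) : Fin n → ZMod p :=
  fun i => Algebra.trace (ZMod p) F (γ * ω ^ (k * (i : ℕ)))

/-- The irreducible cyclic code `C(k,q)` as a finite set of codewords. -/
noncomputable def cycCode (p : ℕ) (F : Type) [Field F] [Fintype F] [Algebra (ZMod p) F]
    (ω : F) (k n : ℕ) : Finset (Fin n → ZMod p) :=
  Finset.image (cycWord p F ω k n) Finset.univ

/-- Hamming weight of a codeword: the number of nonzero coordinates. -/
def wt {p n : ℕ} (c : Fin n → ZMod p) : ℕ :=
  (Finset.univ.filter fun i => c i ≠ 0).card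

/-- `A_w`: the number of codewords of weight `w` in `C(k,q)`. -/
noncomputable def freq (p : ℕ) (F : Type) [Field F] [Fintype F] [Algebra (ZMod p) F]
    (ω : F) (k n w : ℕ) : ℕ :=
  ((cycCode p F ω k n).filter fun c => wt c = w).card

/-- The weight `w_{ℓ1,ℓ2,ℓ3,ℓ4}` of Theorem 5.3 (codes from `C(4,q)`), with `q = p^m`,
`√q = p^(2t)`:
`((p-1)/(4p))·( h·q + (ℓ1+ℓ2-ℓ3-ℓ4)·√q + ( 2A(ℓ1-ℓ2) + 4B(ℓ3-ℓ4) )·p^t )`. -/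
def quarticWeight (p t m : ℕ) (A B : ℤ) (ℓ1 ℓ2 ℓ3 ℓ4 : ℕ) : ℚ :=
  ((p : ℚ) - 1) / (4 * (p : ℚ)) *
    (((ℓ1 : ℚ) + (ℓ2 : ℚ) + (ℓ3 : ℚ) + (ℓ4 : ℚ)) * (p : ℚ) ^ m +
      ((ℓ1 : ℚ) + (ℓ2 : ℚ) - (ℓ3 : ℚ) - (ℓ4 : ℚ)) * (p : ℚ) ^ (2 * t) +
      (2 * (A : ℚ) * ((ℓ1 : ℚ) - (ℓ2 : ℚ)) +
        4 * (B : ℚ) * ((ℓ3 : ℚ) - (ℓ4 : ℚ))) * (p : ℚ) ^ t)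

theorem eq_of_sq_add_sq_eq_prime_pow {p : ℕ} (hp : p.Prime) {s : ℕ}
    (hP : (p : ℤ) ^ s ≡ 1 [ZMOD 4]) {x y A B : ℤ}
    (hxy : x ^ 2 + y ^ 2 = (p : ℤ) ^ s) (hAB : (p : ℤ) ^ s = A ^ 2 + 4 * B ^ 2)
    (hx : x ≡ 1 [ZMOD 4]) (hA : A ≡ 1 [ZMOD 4]) (hy : 2 ∣ y) (h2 : ¬ (p : ℤ) ∣ 2)
    (hpx : ¬ (p : ℤ) ∣ x) (hpA : ¬ (p : ℤ) ∣ A) :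
    x = A ∧ (y = 2 * B ∨ y = -(2 * B)) := by
  have hpZ : Prime (p : ℤ) := Nat.prime_iff_prime_int.mp hp
  have key : ∀ B' : ℤ, (p : ℤ) ^ s = A ^ 2 + 4 * B' ^ 2 →
      ¬ (p : ℤ) ∣ x * A + 2 * (y * B') → x = A ∧ y = -(2 * B') := by
    intro B' hAB' hv
    set P : ℤ := (p : ℤ) ^ s with hPdef
    have hPpos : 0 < P := pow_pos (by exact_mod_cast hp.pos) _
    have huv : (x * A - 2 * (y * B')) * (x * A + 2 * (y * B')) = P * (x ^ 2 - 4 * B' ^ 2) := by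
      have h1 : A ^ 2 = P - 4 * B' ^ 2 := by linarith
      have h3 : y ^ 2 = P - x ^ 2 := by linarith
      calc _ = x ^ 2 * A ^ 2 - 4 * y ^ 2 * B' ^ 2 := by ring
        _ = _ := by rw [h1, h3]; ring
    have hd : P ∣ x * A - 2 * (y * B') := by
      have hc : IsCoprime P (x * A + 2 * (y * B')) :=
        (((hpZ.irreducible.coprime_iff_not_dvd).2 hv)).pow_left
      exact hc.dvd_of_dvd_mul_right ⟨_, huv⟩
    obtain ⟨e, he⟩ := hd
    have hsq : (x * A - 2 * (y * B')) ^ 2 + (2 * x * B' + y * A) ^ 2 = P ^ 2 := by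
      have : P ^ 2 = (x ^ 2 + y ^ 2) * (A ^ 2 + 4 * B' ^ 2) := by rw [hxy, ← hAB']; ring
      rw [this]; ring
    obtain ⟨y', rfl⟩ := hy
    have hmod : x * A - 2 * (2 * y' * B') ≡ 1 [ZMOD 4] := by
      have h1 := hx.mul hA
      have : x * A - 2 * (2 * y' * B') ≡ 1 * 1 - 0 [ZMOD 4] :=
        h1.sub (Int.modEq_zero_iff_dvd.2 ⟨y' * B', by ring⟩)
      simpa using this
    have he1 : e ≡ 1 [ZMOD 4] := by
      have := hP.mul_right e
      rw [← he] at this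
      simpa using this.symm.trans hmod
    have hle : e ^ 2 ≤ 1 := by
      rw [he] at hsq
      by_contra hcon
      have h2e : 2 ≤ e ^ 2 := by omega
      nlinarith [sq_nonneg (2 * x * B' + 2 * y' * A), pow_pos hPpos 2]
    have he' : e = 1 := by
      have h1 : e ≤ 1 := by nlinarith
      have h3 : -1 ≤ e := by nlinarith
      unfold Int.ModEq at he1
      omega
    subst he'
    rw [mul_one] at he
    have hz : 2 * x * B' + 2 * y' * A = 0 := by
      rw [he] at hsq
      have : (2 * x * B' + 2 * y' * A) ^ 2 = 0 := by linarith
      exact pow_eq_zero_iff (two_ne_zero) |>.1 this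
    have hA' : x * P = A * P := by
      calc x * P = A * (x * A - 2 * (2 * y' * B')) + 2 * B' * (2 * x * B' + 2 * y' * A) := by
            rw [hAB']; ring
        _ = A * P := by rw [he, hz]; ring
    have hy' : (2 * y') * P = -(2 * B') * P := by
      calc (2 * y') * P = - (2 * B') * (x * A - 2 * (2 * y' * B')) +
            A * (2 * x * B' + 2 * y' * A) := by rw [hAB']; ring
        _ = _ := by rw [he, hz]; ring
    exact ⟨mul_right_cancel₀ hPpos.ne' hA', mul_right_cancel₀ hPpos.ne' hy'⟩
  by_cases hv : (p : ℤ) ∣ x * A + 2 * (y * B)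
  · have hv' : ¬ (p : ℤ) ∣ x * A + 2 * (y * (-B)) := by
      intro h
      have h4 : (p : ℤ) ∣ 2 * (x * A) := by
        have := dvd_add hv h
        ring_nf at this ⊢
        exact this
      rcases hpZ.dvd_or_dvd h4 with h | h
      · exact h2 h
      · rcases hpZ.dvd_or_dvd h with h | h
        · exact hpx h
        · exact hpA h
    obtain ⟨h1, h3⟩ := key (-B) (by rw [hAB]; ring) hv'
    exact ⟨h1, Or.inl (by rw [h3]; ring)⟩
  · obtain ⟨h1, h3⟩ := key B hAB hv
    exact ⟨h1, Or.inr h3⟩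

theorem not_dvd_choose_three_mul {p : ℕ} (hp : p.Prime) (hp4 : p % 4 = 1) (s : ℕ) :
    ∀ a : ℕ, 4 * a + 1 = p ^ s → ¬ p ∣ (3 * a).choose a := by
  have := Fact.mk hp
  obtain ⟨b, hb⟩ : ∃ b, p = 4 * b + 1 := ⟨p / 4, by omega⟩
  induction s with
  | zero =>
    intro a ha
    have : a = 0 := by simpa using ha
    subst this
    simpa using hp.one_lt.ne'
  | succ s ih =>
    intro a ha
    have hs : p ^ s % 4 = 1 := by rw [Nat.pow_mod, hp4]; simp
    obtain ⟨a', ha'⟩ : ∃ a', 4 * a' + 1 = p ^ s := ⟨p ^ s / 4, by omega⟩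
    have haa : a = p * a' + b := by
      rw [pow_succ, ← ha'] at ha
      have : (4 * a' + 1) * p = 4 * (p * a') + p := by ring
      omega
    have h := Choose.choose_modEq_choose_mod_mul_choose_div_nat (n := 3 * a) (k := a) (p := p)
    have e1 : 3 * a = 3 * b + p * (3 * a') := by rw [haa]; ring
    have e2 : a = b + p * a' := by rw [haa]; ring
    have hm1 : 3 * a % p = 3 * b := by
      rw [e1, Nat.add_mul_mod_self_left, Nat.mod_eq_of_lt (by omega)]
    have hm2 : a % p = b := by
      rw [e2, Nat.add_mul_mod_self_left, Nat.mod_eq_of_lt (by omega)]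
    have hd1 : 3 * a / p = 3 * a' := by
      rw [e1, Nat.add_mul_div_left _ _ hp.pos, Nat.div_eq_of_lt (by omega), zero_add]
    have hd2 : a / p = a' := by
      rw [e2, Nat.add_mul_div_left _ _ hp.pos, Nat.div_eq_of_lt (by omega), zero_add]
    rw [hm1, hm2, hd1, hd2] at h
    intro hdvd
    have h0 := (Nat.modEq_zero_iff_dvd.2 hdvd).symm.trans h
    rcases hp.dvd_mul.1 (Nat.modEq_zero_iff_dvd.1 h0.symm) with h1 | h1
    · have : p ∣ (3 * b).factorial := h1.trans (by
        rw [← Nat.choose_mul_factorial_mul_factorial (show b ≤ 3 * b by omega), mul_assoc]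
        exact dvd_mul_right _ _)
      rw [hp.dvd_factorial] at this
      omega
    · exact ih a' ha' h1

theorem exists_sub_one_mul_four_mul_eq {p : ℕ} (hp : p % 4 = 1) (t : ℕ) :
    ∃ M, (p - 1) * (4 * M) = p ^ (4 * t) - 1 := by
  obtain ⟨b, rfl⟩ : ∃ b, p = 4 * b + 1 := ⟨p / 4, by omega⟩
  obtain ⟨d, hd⟩ : (4 * b + 1 - 1) ∣ (4 * b + 1) ^ t - 1 := Nat.sub_one_dvd_pow_sub_one ..
  have hs : (4 * b + 1) ^ t % 4 = 1 := by rw [Nat.pow_mod, hp]; simp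
  obtain ⟨e, he⟩ : ∃ e, (4 * b + 1) ^ t = 4 * e + 1 := ⟨(4 * b + 1) ^ t / 4, by omega⟩
  have : (4 * b + 1) ^ (4 * t) = (4 * e + 1) ^ 4 := by rw [← he, ← pow_mul, mul_comm t 4]
  rw [this]
  rw [he] at hd
  have hd' : 4 * e = 4 * b * d := by simpa using hd
  refine ⟨d * (2 * e + 1) * ((4 * e + 1) ^ 2 + 1) / 2, ?_⟩
  have h2 : d * (2 * e + 1) * ((4 * e + 1) ^ 2 + 1) / 2 =
      d * (2 * e + 1) * (8 * e ^ 2 + 4 * e + 1) := by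
    apply Nat.div_eq_of_eq_mul_left two_pos; ring
  rw [h2]
  apply Nat.eq_sub_of_add_eq
  have : 4 * b + 1 - 1 = 4 * b := by omega
  rw [this]
  calc _ = (4 * b * d) * (4 * ((2 * e + 1) * (8 * e ^ 2 + 4 * e + 1))) + 1 := by ring
    _ = _ := by rw [← hd']; ring

section FiniteFieldGenerator

variable {F : Type*} [Field F] [Fintype F]

theorem orderOf_eq_card_sub_one {g : F} (hg0 : g ≠ 0) (hg : ∀ x : F, x ≠ 0 → ∃ j : ℕ, g ^ j = x) :
    orderOf g = Fintype.card F - 1 := by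
  classical
  have h : ∀ x : Fˣ, x ∈ Subgroup.zpowers (Units.mk0 g hg0) := by
    intro x
    obtain ⟨j, hj⟩ := hg x x.ne_zero
    exact ⟨j, Units.ext (by simpa using hj)⟩
  rw [← Fintype.card_units, ← Nat.card_eq_fintype_card, ← orderOf_eq_card_of_forall_mem_zpowers h,
    ← orderOf_units, Units.val_mk0]

theorem sum_eq_add_sum_range {M : Type*} [AddCommMonoid M] {g : F} (hg0 : g ≠ 0)
    (hg : ∀ x : F, x ≠ 0 → ∃ j : ℕ, g ^ j = x) (f : F → M) :
    ∑ x, f x = f 0 + ∑ j ∈ Finset.range (Fintype.card F - 1), f (g ^ j) := by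
  classical
  rw [← Finset.add_sum_erase _ _ (Finset.mem_univ (0 : F))]
  congr 1
  symm
  have ho := orderOf_eq_card_sub_one hg0 hg
  refine Finset.sum_bij (fun j _ => g ^ j) ?_ ?_ ?_ ?_
  · intro j _
    simp [hg0]
  · intro i hi j hj hij
    rw [← ho] at hi hj
    exact pow_injOn_Iio_orderOf (by simpa using hi) (by simpa using hj) hij
  · intro x hx
    obtain ⟨j, hj⟩ := hg x (by simpa using hx)
    refine ⟨j % orderOf g, ?_, ?_⟩
    · rw [← ho]
      have : 0 < orderOf g := by
        rw [ho]
        have := Fintype.one_lt_card (α := F)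
        omega
      simpa using Nat.mod_lt _ this
    · simpa [pow_mod_orderOf] using hj
  · intros
    rfl

theorem sum_eq_add_sum_range_four {M : Type*} [AddCommMonoid M] {g : F} (hg0 : g ≠ 0)
    (hg : ∀ x : F, x ≠ 0 → ∃ j : ℕ, g ^ j = x) {c : ℕ} (hc : 4 * c = Fintype.card F - 1)
    (f : F → M) :
    ∑ x, f x = f 0 + ∑ i ∈ Finset.range c,
      (f (g ^ (4 * i)) + f (g ^ (4 * i + 1)) + f (g ^ (4 * i + 2)) + f (g ^ (4 * i + 3))) := by
  rw [sum_eq_add_sum_range hg0 hg, ← hc]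
  congr 1
  clear hc
  induction c with
  | zero => simp
  | succ c ih =>
    rw [Finset.sum_range_succ, ← ih, show 4 * (c + 1) = 4 * c + 1 + 1 + 1 + 1 by ring]
    simp only [Finset.sum_range_succ]
    simp only [add_assoc]

end FiniteFieldGenerator

/-- The restriction of a multiplicative character to a subfield. -/
def MulChar.baseRestrict {R : Type*} [CommRing R] (K : Type*) {F : Type*} [Field K] [Field F]
    [Algebra K F] (χ : MulChar F R) : MulChar K R where
  toMonoidHom := χ.toMonoidHom.comp (algebraMap K F : K →* F)
  map_nonunit' a ha := by
    have : a = 0 := by simpa using ha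
    subst this
    simp

theorem MulChar.baseRestrict_apply {R : Type*} [CommRing R] {K F : Type*} [Field K] [Field F] [Algebra K F]
    (χ : MulChar F R) (y : K) :
    χ.baseRestrict K y = χ (algebraMap K F y) := rfl

section QuadraticExtension

variable {K F : Type*} [Field K] [Fintype K] [Field F] [Fintype F] [Algebra K F]

theorem algebraMap_trace_eq_add_pow (h : Fintype.card F = Fintype.card K ^ 2) (x : F) :
    algebraMap K F (Algebra.trace K F x) = x + x ^ Fintype.card K := by
  have hf : Module.finrank K F = 2 := by
    have := Module.card_eq_pow_finrank (K := K) (V := F)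
    rw [h] at this
    exact (Nat.pow_right_injective (Fintype.one_lt_card (α := K)) this).symm
  rw [FiniteField.algebraMap_trace_eq_sum_pow, hf, Nat.card_eq_fintype_card]
  simp [Finset.sum_range_succ]

theorem card_trace_fiber [DecidableEq K] (h : Fintype.card F = Fintype.card K ^ 2) (τ : K) :
    (Finset.univ.filter fun x : F => Algebra.trace K F x = τ).card = Fintype.card K := by
  classical
  have hs := Algebra.trace_surjective K F
  have hτ : ∀ σ : K, (Finset.univ.filter fun x : F => Algebra.trace K F x = σ).card =
      (Finset.univ.filter fun x : F => Algebra.trace K F x = τ).card := fun σ =>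
    AddMonoidHom.card_fiber_eq_of_mem_range (Algebra.trace K F) (hs σ) (hs τ)
  have h1 := Finset.card_eq_sum_card_fiberwise (f := Algebra.trace K F)
    (s := (Finset.univ : Finset F)) (t := (Finset.univ : Finset K)) (fun _ _ => by simp)
  rw [Finset.sum_congr rfl (fun σ _ => hτ σ), Finset.card_univ, h, Finset.sum_const,
    Finset.card_univ, smul_eq_mul, sq] at h1
  exact (Nat.eq_of_mul_eq_mul_left Fintype.card_pos h1).symm

theorem card_sub_one_mul_gaussSum (χ : MulChar F ℂ) (ψ : AddChar K ℂ) :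
    ((Fintype.card K : ℂ) - 1) *
        gaussSum χ (ψ.compAddMonoidHom (Algebra.trace K F : F →+ K)) =
      ∑ x : F, χ x * gaussSum (χ.baseRestrict K) (ψ.mulShift (Algebra.trace K F x)) := by
  classical
  have h1 : ∀ y : Kˣ, gaussSum χ (ψ.compAddMonoidHom (Algebra.trace K F : F →+ K)) =
      ∑ x : F, χ x * (χ.baseRestrict K y * ψ.mulShift (Algebra.trace K F x) y) := by
    intro y
    rw [gaussSum]
    symm
    refine Fintype.sum_bijective _ (Units.map (algebraMap K F : K →* F) y).mulLeft_bijective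
      _ _ fun x => ?_
    simp only [Units.coe_map, MonoidHom.coe_coe, map_mul, MulChar.baseRestrict_apply,
      AddChar.mulShift_apply, AddChar.compAddMonoidHom_apply]
    have : Algebra.trace K F (algebraMap K F y * x) = Algebra.trace K F x * y := by
      rw [← Algebra.smul_def, map_smul, smul_eq_mul, mul_comm]
    rw [show (Algebra.trace K F : F →+ K) (algebraMap K F y * x) =
      Algebra.trace K F (algebraMap K F y * x) from rfl, this]
    ring
  have h2 : ∑ y : Kˣ, gaussSum χ (ψ.compAddMonoidHom (Algebra.trace K F : F →+ K)) =
      ∑ y : Kˣ, ∑ x : F, χ x * (χ.baseRestrict K y * ψ.mulShift (Algebra.trace K F x) y) :=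
    Finset.sum_congr rfl fun y _ => h1 y
  rw [Finset.sum_const, Finset.card_univ, Fintype.card_units, nsmul_eq_mul,
    Nat.cast_sub Fintype.card_pos, Nat.cast_one] at h2
  rw [h2, Finset.sum_comm]
  refine Finset.sum_congr rfl fun x _ => ?_
  rw [← Finset.mul_sum, gaussSum]
  congr 1
  rw [← Finset.add_sum_erase _ _ (Finset.mem_univ (0 : K)), MulChar.map_zero, zero_mul, zero_add]
  refine Finset.sum_bij (fun (y : Kˣ) _ => (y : K)) ?_ ?_ ?_ ?_
  · intro y _
    simp
  · intro a _ b _ hab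
    exact Units.ext hab
  · intro b hb
    exact ⟨Units.mk0 b (by simpa using hb), Finset.mem_univ _, rfl⟩
  · intros
    rfl

theorem gaussSum_eq_gaussSum_baseRestrict_mul [DecidableEq K] (χ : MulChar F ℂ)
    (hχ : χ.baseRestrict K ≠ 1) (ψ : AddChar K ℂ) :
    gaussSum χ (ψ.compAddMonoidHom (Algebra.trace K F : F →+ K)) =
      gaussSum (χ.baseRestrict K) ψ *
        ∑ x ∈ Finset.univ.filter (fun x : F => Algebra.trace K F x = 1), χ x := by
  have hQ : ((Fintype.card K : ℂ) - 1) ≠ 0 := by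
    have := Fintype.one_lt_card (α := K)
    rw [sub_ne_zero]
    exact_mod_cast this.ne'
  apply mul_left_cancel₀ hQ
  rw [card_sub_one_mul_gaussSum]
  have hfib := Finset.sum_fiberwise (Finset.univ : Finset F) (fun x => Algebra.trace K F x)
    (fun x => χ x * gaussSum (χ.baseRestrict K) (ψ.mulShift (Algebra.trace K F x)))
  rw [← hfib, ← Finset.add_sum_erase _ _ (Finset.mem_univ (0 : K))]
  have hzero : ∑ x ∈ Finset.univ.filter (fun x : F => Algebra.trace K F x = 0),
      χ x * gaussSum (χ.baseRestrict K) (ψ.mulShift (Algebra.trace K F x)) = 0 := by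
    refine Finset.sum_eq_zero fun x hx => ?_
    rw [(Finset.mem_filter.1 hx).2, AddChar.mulShift_zero, gaussSum_one_right hχ, mul_zero]
  rw [hzero, zero_add]
  have hterm : ∀ τ ∈ Finset.univ.erase (0 : K),
      ∑ x ∈ Finset.univ.filter (fun x : F => Algebra.trace K F x = τ),
        χ x * gaussSum (χ.baseRestrict K) (ψ.mulShift (Algebra.trace K F x)) =
      gaussSum (χ.baseRestrict K) ψ *
        ∑ x ∈ Finset.univ.filter (fun x : F => Algebra.trace K F x = 1), χ x := by
    intro τ hτ
    have hτ0 : τ ≠ 0 := by simpa using hτ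
    have hτF : algebraMap K F τ ≠ 0 := by simpa using hτ0
    rw [Finset.mul_sum]
    symm
    refine Finset.sum_bij (fun x _ => algebraMap K F τ * x) ?_ ?_ ?_ ?_
    · intro x hx
      have := (Finset.mem_filter.1 hx).2
      simp [← Algebra.smul_def, map_smul, this]
    · intro a _ b _ hab
      exact mul_left_cancel₀ hτF hab
    · intro b hb
      have := (Finset.mem_filter.1 hb).2
      refine ⟨algebraMap K F τ⁻¹ * b, ?_, ?_⟩
      · simp only [Finset.mem_filter, Finset.mem_univ, true_and]
        rw [← Algebra.smul_def, map_smul, this, smul_eq_mul, inv_mul_cancel₀ hτ0]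
      · rw [← mul_assoc, ← map_mul, mul_inv_cancel₀ hτ0, map_one, one_mul]
    · intro x hx
      have hx1 := (Finset.mem_filter.1 hx).2
      have ht : Algebra.trace K F (algebraMap K F τ * x) = τ := by
        rw [← Algebra.smul_def, map_smul, hx1, smul_eq_mul, mul_one]
      rw [ht, map_mul]
      have := gaussSum_mulShift (χ.baseRestrict K) ψ (Units.mk0 τ hτ0)
      rw [Units.val_mk0, MulChar.baseRestrict_apply] at this
      rw [← this]
      ring
  rw [Finset.sum_congr rfl hterm, Finset.sum_const, Finset.card_erase_of_mem (Finset.mem_univ _),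
    Finset.card_univ, nsmul_eq_mul, Nat.cast_sub Fintype.card_pos, Nat.cast_one]

theorem gaussSum_eq_neg_card_of_generator (h : Fintype.card F = Fintype.card K ^ 2)
    (hK : Fintype.card K % 4 = 1) {g : F} (hg0 : g ≠ 0)
    (hg : ∀ x : F, x ≠ 0 → ∃ j : ℕ, g ^ j = x)
    (χ : MulChar F ℂ) (hχ : χ g = -1) (ψ : AddChar K ℂ) (hψ : ψ ≠ 1) :
    gaussSum χ (ψ.compAddMonoidHom (Algebra.trace K F : F →+ K)) = -(Fintype.card K : ℂ) := by
  classical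
  have ho := orderOf_eq_card_sub_one hg0 hg
  set Q := Fintype.card K with hQdef
  have hQ1 : 1 < Q := Fintype.one_lt_card
  have hfac : Fintype.card F - 1 = (Q + 1) * (Q - 1) := by
    rw [h]
    simpa using Nat.sq_sub_sq Q 1
  have hQne : ((Q : ℂ) - 1) ≠ 0 := by
    rw [sub_ne_zero]
    exact_mod_cast hQ1.ne'
  have hdvd : ∀ j : ℕ, (g ^ j) ^ (Q - 1) = 1 ↔ Q + 1 ∣ j := by
    intro j
    rw [← pow_mul, ← orderOf_dvd_iff_pow_eq_one, ho, hfac]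
    exact Nat.mul_dvd_mul_iff_right (by omega)
  have hF0 : ∀ x : F, Algebra.trace K F x = 0 ↔ x + x ^ Q = 0 := by
    intro x
    rw [← algebraMap_trace_eq_add_pow h, map_eq_zero_iff _ (algebraMap K F).injective]
  have hsplit : ∀ x : F, x ^ Q = x * x ^ (Q - 1) := by
    intro x
    rw [← pow_succ', Nat.sub_add_cancel hQ1.le]
  have h2 : (2 : F) ≠ 0 := by
    have hodd : ringChar F ≠ 2 := by
      apply FiniteField.even_card_iff_char_two.not.2
      rw [h, Nat.pow_mod, show Fintype.card K % 2 = 1 by omega]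
      norm_num
    exact Ring.two_ne_zero hodd
  have hbase : χ.baseRestrict K = 1 := by
    ext y
    rw [MulChar.baseRestrict_apply, MulChar.one_apply_coe]
    have hy0 : algebraMap K F (y : K) ≠ 0 := by simp
    obtain ⟨j, hj⟩ := hg _ hy0
    have : Q + 1 ∣ j := by
      rw [← hdvd, hj, ← map_pow, FiniteField.pow_card_sub_one_eq_one _ y.ne_zero, map_one]
    obtain ⟨e, rfl⟩ := this
    rw [← hj, map_pow, hχ, pow_mul, Even.neg_one_pow (by rw [Nat.even_iff]; omega), one_pow]
  have hnt : ∀ x : F, Algebra.trace K F x = 0 → x ≠ 0 → χ x = -1 := by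
    intro x hx hx0
    rw [hF0, hsplit] at hx
    have hx1 : x ^ (Q - 1) = -1 := by
      have : x * (1 + x ^ (Q - 1)) = 0 := by linear_combination hx
      rcases mul_eq_zero.1 this with h' | h'
      · exact absurd h' hx0
      · linear_combination h'
    obtain ⟨j, rfl⟩ := hg x hx0
    have hn : ¬ Q + 1 ∣ j := by
      rw [← hdvd, hx1]
      intro h'
      apply h2
      linear_combination -h'
    have hd : Q + 1 ∣ 2 * j := by
      rw [← hdvd, mul_comm, pow_mul, pow_right_comm, hx1]
      norm_num
    rw [map_pow, hχ]
    apply Odd.neg_one_pow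
    by_contra hj
    rw [Nat.not_odd_iff_even] at hj
    obtain ⟨i, rfl⟩ := hj
    apply hn
    obtain ⟨e, he⟩ : ∃ e, Q = 4 * e + 1 := ⟨Q / 4, by omega⟩
    rw [he] at hd ⊢
    have h3 : 2 * e + 1 ∣ 2 * i := by
      apply Nat.dvd_of_mul_dvd_mul_left two_pos
      convert hd using 1 <;> ring
    have h4 : 2 * e + 1 ∣ i := by
      refine Nat.Coprime.dvd_of_dvd_mul_left ?_ h3
      simp
    obtain ⟨f, rfl⟩ := h4
    exact ⟨f, by ring⟩
  have hχ1 : χ ≠ 1 := by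
    rintro rfl
    rw [MulChar.one_apply (by simpa using hg0)] at hχ
    norm_num at hχ
  apply mul_left_cancel₀ hQne
  rw [hQdef, card_sub_one_mul_gaussSum, hbase, ← hQdef]
  have hterm : ∀ x : F, χ x * gaussSum (1 : MulChar K ℂ) (ψ.mulShift (Algebra.trace K F x)) =
      (if Algebra.trace K F x = 0 then (Q : ℂ) * χ x else 0) - χ x := by
    intro x
    split_ifs with hx
    · rw [hx, AddChar.mulShift_zero, gaussSum_one_one, Nat.card_eq_fintype_card,
        Fintype.card_units, Nat.cast_sub hQ1.le]
      push_cast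
      ring
    · rw [gaussSum_one_left]
      · ring
      · have := AddChar.IsPrimitive.of_ne_one hψ
        exact this hx
  rw [Finset.sum_congr rfl fun x _ => hterm x, Finset.sum_sub_distrib,
    MulChar.sum_eq_zero_of_ne_one hχ1, sub_zero, ← Finset.sum_filter,
    ← Finset.add_sum_erase _ _ (show (0 : F) ∈ Finset.univ.filter
      (fun x : F => Algebra.trace K F x = 0) by simp), MulChar.map_zero, mul_zero, zero_add]
  rw [Finset.sum_congr rfl (g := fun _ => -(Q : ℂ))]
  · rw [Finset.sum_const, Finset.card_erase_of_mem (by simp), card_trace_fiber h, nsmul_eq_mul,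
      Nat.cast_sub hQ1.le, Nat.cast_one]
  · intro x hx
    rw [Finset.mem_erase, Finset.mem_filter] at hx
    rw [hnt x hx.2.2 hx.1]
    ring

end QuadraticExtension

section QuarticGaussSum

theorem two_dvd_sum_erase_of_even {K : Type*} [Field K] [Fintype K] [DecidableEq K]
    (h2 : (2 : K) ≠ 0) (f : K → ℤ) (hf : ∀ s, f (-s) = f s) :
    (2 : ℤ) ∣ ∑ s ∈ Finset.univ.erase (0 : K), f s := by
  have : ((∑ s ∈ Finset.univ.erase (0 : K), f s : ℤ) : ZMod 2) = 0 := by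
    rw [Int.cast_sum]
    refine Finset.sum_involution (fun s _ => -s) ?_ ?_ ?_ ?_
    · intro s _
      rw [hf]
      exact CharTwo.add_self_eq_zero _
    · intro s hs _ hss
      have hs0 : s ≠ 0 := by simpa using hs
      have : 2 * s = 0 := by linear_combination -hss
      rcases mul_eq_zero.1 this with h | h
      · exact h2 h
      · exact hs0 h
    · intro s hs
      simpa using hs
    · intro s _
      simp
  exact_mod_cast (ZMod.intCast_zmod_eq_zero_iff_dvd _ 2).1 this

theorem sum_pow_eq_ite {K : Type*} [Field K] [Fintype K] (k : ℕ) (hk : 0 < k) :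
    ∑ s : K, s ^ k = if Fintype.card K - 1 ∣ k then -1 else 0 := by
  classical
  rw [← FiniteField.sum_pow_units K k, ← Finset.add_sum_erase _ _ (Finset.mem_univ (0 : K)),
    zero_pow hk.ne', zero_add]
  symm
  refine Finset.sum_bij (fun (y : Kˣ) _ => (y : K)) ?_ ?_ ?_ ?_
  · intro y _
    simp
  · intro a _ b _ hab
    exact Units.ext hab
  · intro b hb
    exact ⟨Units.mk0 b (by simpa using hb), Finset.mem_univ _, rfl⟩
  · intros
    rfl

theorem sum_add_mul_sq_pow {K F : Type*} [Field K] [Fintype K] [Field F] [Algebra K F] {a : ℕ}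
    (ha : 4 * a + 1 = Fintype.card K) (A B : F) :
    ∑ s : K, (A + B * (algebraMap K F s) ^ 2) ^ (3 * a) =
      -((3 * a).choose a * (A ^ a * B ^ (2 * a))) := by
  have ha0 : 0 < a := by
    have := Fintype.one_lt_card (α := K)
    omega
  have h1 : ∀ s : K, (A + B * (algebraMap K F s) ^ 2) ^ (3 * a) =
      ∑ i ∈ Finset.range (3 * a + 1),
        (B ^ i * A ^ (3 * a - i) * (3 * a).choose i) * algebraMap K F (s ^ (2 * i)) := by
    intro s
    rw [add_comm, add_pow]
    refine Finset.sum_congr rfl fun i _ => ?_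
    rw [mul_pow, ← pow_mul, map_pow]
    ring
  rw [Finset.sum_congr rfl fun s _ => h1 s, Finset.sum_comm]
  simp_rw [← Finset.mul_sum, ← map_sum]
  rw [Finset.sum_eq_single (2 * a)]
  · rw [sum_pow_eq_ite _ (by omega), if_pos (by rw [← ha]; exact ⟨1, by omega⟩),
      show (3 * a).choose (2 * a) = (3 * a).choose a by
        rw [← Nat.choose_symm (by omega)]; congr 1; omega,
      show 3 * a - 2 * a = a by omega]
    simp
    ring
  · intro i hi hne
    have hi' : i < 3 * a + 1 := by simpa using hi
    rcases Nat.eq_zero_or_pos i with rfl | hpos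
    · rw [FiniteField.sum_pow_lt_card_sub_one _ _ (by omega)]
      simp
    · rw [sum_pow_eq_ite _ (by omega), if_neg, map_zero, mul_zero]
      rintro ⟨e, he⟩
      rw [← ha, Nat.add_sub_cancel] at he
      have : e = 1 := by
        have h3 : e < 2 := by
          by_contra hcon
          have : 4 * a * 2 ≤ 4 * a * e := Nat.mul_le_mul_left _ (by omega)
          omega
        have : e ≠ 0 := by
          rintro rfl
          omega
        omega
      subst this
      omega
  · intro hni
    exact absurd (Finset.mem_range.2 (by omega)) hni

theorem gaussianInt_I_pow_cases (j : ℕ) :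
    (⟨0, 1⟩ : GaussianInt) ^ j = ⟨1, 0⟩ ∨ (⟨0, 1⟩ : GaussianInt) ^ j = ⟨0, 1⟩ ∨
      (⟨0, 1⟩ : GaussianInt) ^ j = ⟨-1, 0⟩ ∨ (⟨0, 1⟩ : GaussianInt) ^ j = ⟨0, -1⟩ := by
  induction j with
  | zero => left; rfl
  | succ j ih =>
    rw [pow_succ]
    rcases ih with h | h | h | h <;> rw [h]
    · right; left; rfl
    · right; right; left; rfl
    · right; right; right; rfl
    · left; rfl

/-- The real part of a Gaussian integer, as an additive homomorphism. -/
def GaussianInt.reHom : GaussianInt →+ ℤ where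
  toFun := Zsqrtd.re
  map_zero' := rfl
  map_add' _ _ := rfl

/-- The imaginary part of a Gaussian integer, as an additive homomorphism. -/
def GaussianInt.imHom : GaussianInt →+ ℤ where
  toFun := Zsqrtd.im
  map_zero' := rfl
  map_add' _ _ := rfl

variable {K F : Type*} [Field K] [Fintype K] [Field F] [Fintype F] [Algebra K F]

theorem exists_sum_trace_eq_one [DecidableEq K] (h : Fintype.card F = Fintype.card K ^ 2)
    (h2 : (2 : F) ≠ 0) :
    ∃ δ : F, δ ≠ 0 ∧
      (∀ s : K, Algebra.trace K F (2⁻¹ + algebraMap K F s * δ) = 1) ∧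
      (∀ s : K, (2⁻¹ + algebraMap K F s * δ) ^ Fintype.card K = 2⁻¹ + algebraMap K F (-s) * δ) ∧
      ∀ {M : Type} [AddCommMonoid M] (f : F → M),
        ∑ x ∈ Finset.univ.filter (fun x : F => Algebra.trace K F x = 1), f x =
          ∑ s : K, f (2⁻¹ + algebraMap K F s * δ) := by
  classical
  obtain ⟨δ, hδ, hδ0⟩ : ∃ δ ∈ Finset.univ.filter (fun x : F => Algebra.trace K F x = 0), δ ≠ 0 := by
    apply Finset.exists_mem_ne
    rw [card_trace_fiber h]
    exact Fintype.one_lt_card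
  have hδt : Algebra.trace K F δ = 0 := (Finset.mem_filter.1 hδ).2
  have htr : ∀ s : K, Algebra.trace K F (2⁻¹ + algebraMap K F s * δ) = 1 := by
    intro s
    rw [map_add, ← Algebra.smul_def, map_smul, hδt, smul_zero, add_zero]
    apply (algebraMap K F).injective
    rw [algebraMap_trace_eq_add_pow h, map_one]
    have : (2⁻¹ : F) = algebraMap K F 2⁻¹ := by rw [map_inv₀, map_ofNat]
    rw [this, ← map_pow, FiniteField.pow_card, ← this]
    field_simp
    norm_num
  refine ⟨δ, hδ0, htr, ?_, ?_⟩
  · intro s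
    have h3 := algebraMap_trace_eq_add_pow h (2⁻¹ + algebraMap K F s * δ)
    rw [htr, map_one] at h3
    have h4 : (2⁻¹ : F) + 2⁻¹ = 1 := by
      field_simp
      norm_num
    rw [map_neg]
    linear_combination -h3 - h4
  · intro M _ f
    have himg : Finset.univ.image (fun s : K => 2⁻¹ + algebraMap K F s * δ) =
        Finset.univ.filter (fun x : F => Algebra.trace K F x = 1) := by
      apply Finset.eq_of_subset_of_card_le
      · intro x hx
        obtain ⟨s, _, rfl⟩ := Finset.mem_image.1 hx
        simpa using htr s
      · rw [card_trace_fiber h, Finset.card_image_of_injective, Finset.card_univ]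
        intro s s' hs
        exact (algebraMap K F).injective (mul_right_cancel₀ hδ0 (add_left_cancel hs))
    rw [← himg, Finset.sum_image]
    intro s _ s' _ hs
    exact (algebraMap K F).injective (mul_right_cancel₀ hδ0 (add_left_cancel hs))

theorem exists_generator_baseRestrict (h : Fintype.card F = Fintype.card K ^ 2)
    (hK : Fintype.card K % 4 = 1) {g : F} (hg0 : g ≠ 0)
    (hg : ∀ x : F, x ≠ 0 → ∃ j : ℕ, g ^ j = x) :
    ∃ y : K, y ≠ 0 ∧ (∀ x : K, x ≠ 0 → ∃ j : ℕ, y ^ j = x) ∧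
      ∃ e : ℕ, algebraMap K F y = g ^ (4 * e + 2) := by
  obtain ⟨y, hy⟩ := IsCyclic.exists_generator (α := Kˣ)
  have hgen : ∀ x : K, x ≠ 0 → ∃ j : ℕ, (y : K) ^ j = x := by
    intro x hx
    obtain ⟨j, hj⟩ := mem_powers_iff_mem_zpowers.2 (hy (Units.mk0 x hx))
    exact ⟨j, by simpa using congrArg Units.val hj⟩
  refine ⟨y, y.ne_zero, hgen, ?_⟩
  have hoy := orderOf_eq_card_sub_one y.ne_zero hgen
  have ho := orderOf_eq_card_sub_one hg0 hg
  have hQ1 : 1 < Fintype.card K := Fintype.one_lt_card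
  obtain ⟨j, hj⟩ := hg (algebraMap K F (y : K)) (by simp)
  obtain ⟨a, ha⟩ : ∃ a, Fintype.card K = 4 * a + 1 := ⟨Fintype.card K / 4, by omega⟩
  have hfac : Fintype.card F - 1 = (4 * a + 2) * (4 * a) := by
    rw [h, ha]
    apply Nat.sub_eq_of_eq_add
    ring
  have hoF : orderOf (algebraMap K F (y : K)) = 4 * a := by
    have := orderOf_injective (algebraMap K F : K →* F) (algebraMap K F).injective (y : K)
    exact this.trans (by rw [hoy, ha, Nat.add_sub_cancel])
  have hd : 4 * a + 2 ∣ j := by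
    have : (g ^ j) ^ (4 * a) = 1 := by rw [hj, ← hoF, pow_orderOf_eq_one]
    rw [← pow_mul, ← orderOf_dvd_iff_pow_eq_one, ho, hfac] at this
    exact Nat.dvd_of_mul_dvd_mul_right (by omega) this
  obtain ⟨e, rfl⟩ := hd
  have hodd : e % 2 = 1 := by
    by_contra hcon
    obtain ⟨f, rfl⟩ : ∃ f, e = 2 * f := ⟨e / 2, by omega⟩
    have : (g ^ ((4 * a + 2) * (2 * f))) ^ (2 * a) = 1 := by
      rw [← pow_mul, ← orderOf_dvd_iff_pow_eq_one, ho, hfac]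
      exact ⟨f, by ring⟩
    rw [hj, ← orderOf_dvd_iff_pow_eq_one, hoF] at this
    have := Nat.le_of_dvd (by omega) this
    omega
  obtain ⟨f, rfl⟩ : ∃ f, e = 2 * f + 1 := ⟨e / 2, by omega⟩
  exact ⟨2 * a * f + a + f, by rw [← hj]; congr 1; ring⟩

theorem quartic_apply_eq_one_of_pow_eq_one {p t : ℕ} (hp : 1 < p) (hp4 : p % 4 = 1)
    (hF : Fintype.card F = p ^ (4 * t)) {g : F} (hg0 : g ≠ 0)
    (hg : ∀ x : F, x ≠ 0 → ∃ j : ℕ, g ^ j = x) {χ : MulChar F GaussianInt} (hχ : χ g = ⟨0, 1⟩)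
    {x : F} (hx : x ^ (p - 1) = 1) : χ x = 1 := by
  have hx0 : x ≠ 0 := by
    rintro rfl
    rw [zero_pow (by omega)] at hx
    exact zero_ne_one hx
  obtain ⟨j, rfl⟩ := hg x hx0
  obtain ⟨M, hM⟩ := exists_sub_one_mul_four_mul_eq hp4 t
  rw [← pow_mul, ← orderOf_dvd_iff_pow_eq_one, orderOf_eq_card_sub_one hg0 hg, hF, ← hM,
    mul_comm j] at hx
  have h4 : 4 ∣ j := (Dvd.intro M rfl).trans (Nat.dvd_of_mul_dvd_mul_left (by omega) hx)
  obtain ⟨e, rfl⟩ := h4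
  rw [map_pow, hχ, pow_mul, show (⟨0, 1⟩ : GaussianInt) ^ 4 = 1 from rfl, one_pow]

/-- The congruences satisfied by the sum of a quartic character over the elements of trace `1`. -/
theorem sum_trace_eq_one_congr [DecidableEq K] {p t : ℕ} [Fact p.Prime] [Algebra (ZMod p) F]
    (hp4 : p % 4 = 1)
    (hK : Fintype.card K = p ^ (2 * t)) (hF : Fintype.card F = p ^ (4 * t)) {g : F} (hg0 : g ≠ 0)
    (hg : ∀ x : F, x ≠ 0 → ∃ j : ℕ, g ^ j = x) {χ : MulChar F GaussianInt} (hχ : χ g = ⟨0, 1⟩)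
    {x y : ℤ}
    (hxy : ∑ z ∈ Finset.univ.filter (fun z : F => Algebra.trace K F z = 1), χ z = ⟨x, y⟩) :
    (x + y) % 4 = 1 ∧ y % 2 = 0 ∧ ¬ ((p : ℤ) ∣ x ∧ (p : ℤ) ∣ y) := by
  have hp : p.Prime := Fact.out
  have hp5 : 5 ≤ p := by
    have := hp.two_le
    omega
  have hFK : Fintype.card F = Fintype.card K ^ 2 := by
    rw [hF, hK, ← pow_mul]
    congr 1
    ring
  have hcharP : CharP F p := charP_of_injective_algebraMap (algebraMap (ZMod p) F).injective p
  have hK4 : Fintype.card K % 4 = 1 := by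
    rw [hK, Nat.pow_mod, hp4]
    simp
  have h2 : (2 : F) ≠ 0 := by
    have := (CharP.cast_eq_zero_iff F p 2).not.2 (fun h => by
      have := Nat.le_of_dvd two_pos h
      omega)
    exact_mod_cast this
  have h2K : (2 : K) ≠ 0 := by
    intro h0
    apply h2
    rw [← map_ofNat (algebraMap K F), h0, map_zero]
  obtain ⟨δ, hδ0, htr, hpow, hsum⟩ := exists_sum_trace_eq_one (K := K) hFK h2
  have hne : ∀ s : K, 2⁻¹ + algebraMap K F s * δ ≠ 0 := by
    intro s h0
    have := htr s
    rw [h0, map_zero] at this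
    exact zero_ne_one this
  have hcases : ∀ s : K, χ (2⁻¹ + algebraMap K F s * δ) = ⟨1, 0⟩ ∨
      χ (2⁻¹ + algebraMap K F s * δ) = ⟨0, 1⟩ ∨ χ (2⁻¹ + algebraMap K F s * δ) = ⟨-1, 0⟩ ∨
      χ (2⁻¹ + algebraMap K F s * δ) = ⟨0, -1⟩ := by
    intro s
    obtain ⟨j, hj⟩ := hg _ (hne s)
    rw [← hj, map_pow, hχ]
    exact gaussianInt_I_pow_cases j
  have heven : ∀ s : K, χ (2⁻¹ + algebraMap K F (-s) * δ) = χ (2⁻¹ + algebraMap K F s * δ) := by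
    intro s
    obtain ⟨a, ha⟩ : ∃ a, Fintype.card K = 4 * a + 1 := ⟨Fintype.card K / 4, by omega⟩
    rw [← hpow, map_pow, ha, pow_succ, pow_mul]
    have : χ (2⁻¹ + algebraMap K F s * δ) ^ 4 = 1 := by
      rcases hcases s with h | h | h | h <;> rw [h] <;> rfl
    rw [this, one_pow, one_mul]
  have hzero : χ (2⁻¹ + algebraMap K F 0 * δ) = 1 := by
    rw [map_zero, zero_mul, add_zero]
    refine quartic_apply_eq_one_of_pow_eq_one hp.one_lt hp4 hF hg0 hg hχ ?_
    have h2Z : (2 : ZMod p) ≠ 0 := by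
      intro h0
      apply h2
      rw [← map_ofNat (algebraMap (ZMod p) F), h0, map_zero]
    have : (2⁻¹ : F) = algebraMap (ZMod p) F 2⁻¹ := by rw [map_inv₀, map_ofNat]
    rw [this, ← map_pow, ZMod.pow_card_sub_one_eq_one (inv_ne_zero h2Z), map_one]
  rw [hsum] at hxy
  have hxs : x = ∑ s : K, (χ (2⁻¹ + algebraMap K F s * δ)).re := by
    have := congrArg GaussianInt.reHom hxy
    rw [map_sum] at this
    exact this.symm
  have hys : y = ∑ s : K, (χ (2⁻¹ + algebraMap K F s * δ)).im := by
    have := congrArg GaussianInt.imHom hxy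
    rw [map_sum] at this
    exact this.symm
  refine ⟨?_, ?_, ?_⟩
  · have hv : ∀ s : K, ((χ (2⁻¹ + algebraMap K F s * δ)).re +
        (χ (2⁻¹ + algebraMap K F s * δ)).im) =
        1 + 2 * (((χ (2⁻¹ + algebraMap K F s * δ)).re +
          (χ (2⁻¹ + algebraMap K F s * δ)).im - 1) / 2) := by
      intro s
      rcases hcases s with h | h | h | h <;> rw [h] <;> norm_num
    have hs : x + y = ∑ s : K, (1 + 2 * (((χ (2⁻¹ + algebraMap K F s * δ)).re +
        (χ (2⁻¹ + algebraMap K F s * δ)).im - 1) / 2)) := by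
      rw [hxs, hys, ← Finset.sum_add_distrib]
      exact Finset.sum_congr rfl fun s _ => hv s
    rw [Finset.sum_add_distrib, ← Finset.mul_sum, Finset.sum_const, Finset.card_univ,
      ← Finset.add_sum_erase _ _ (Finset.mem_univ (0 : K)), hzero] at hs
    obtain ⟨e, he⟩ := two_dvd_sum_erase_of_even h2K
      (fun s : K => ((χ (2⁻¹ + algebraMap K F s * δ)).re +
        (χ (2⁻¹ + algebraMap K F s * δ)).im - 1) / 2) (fun s => by rw [heven])
    rw [he] at hs
    simp only [nsmul_eq_mul, Zsqrtd.re_one, Zsqrtd.im_one] at hs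
    omega
  · rw [← Finset.add_sum_erase _ _ (Finset.mem_univ (0 : K)), hzero] at hys
    obtain ⟨e, he⟩ := two_dvd_sum_erase_of_even h2K
      (fun s : K => (χ (2⁻¹ + algebraMap K F s * δ)).im) (fun s => by rw [heven])
    rw [he, Zsqrtd.im_one] at hys
    omega
  · rintro ⟨hpx, hpy⟩
    obtain ⟨a, ha⟩ : ∃ a, Fintype.card K = 4 * a + 1 := ⟨Fintype.card K / 4, by omega⟩
    have ho := orderOf_eq_card_sub_one hg0 hg
    have hfac : Fintype.card F - 1 = 8 * (a * (2 * a + 1)) := by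
      rw [hFK, ha]
      apply Nat.sub_eq_of_eq_add
      ring
    have hQ1 : 1 < Fintype.card K := Fintype.one_lt_card
    have hhalf : g ^ (4 * (a * (2 * a + 1))) = -1 := by
      have hsq : (g ^ (4 * (a * (2 * a + 1)))) ^ 2 = 1 := by
        rw [← pow_mul, ← orderOf_dvd_iff_pow_eq_one, ho, hfac]
        exact ⟨1, by ring⟩
      rw [sq] at hsq
      rcases mul_self_eq_one_iff.1 hsq with h | h
      · rw [← orderOf_dvd_iff_pow_eq_one, ho, hfac] at h
        have hpos : 0 < a * (2 * a + 1) := by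
          apply Nat.mul_pos <;> omega
        have := Nat.le_of_dvd (by omega) h
        omega
      · exact h
    have hu : (g ^ (6 * (a * (2 * a + 1)))) * (g ^ (6 * (a * (2 * a + 1)))) = ((-1 : ℤ) : F) := by
      have : (g ^ (6 * (a * (2 * a + 1)))) * (g ^ (6 * (a * (2 * a + 1)))) =
          (g ^ (4 * (a * (2 * a + 1)))) ^ 3 := by ring
      rw [this, hhalf]
      norm_num
    set φ : GaussianInt →+* F := Zsqrtd.lift ⟨g ^ (6 * (a * (2 * a + 1))), hu⟩ with hφdef
    have hφ : ∀ z : F, z ≠ 0 → φ (χ z) = z ^ (6 * (a * (2 * a + 1))) := by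
      intro z hz
      obtain ⟨j, rfl⟩ := hg z hz
      rw [map_pow, hχ, map_pow, hφdef, Zsqrtd.lift_apply_apply]
      push_cast
      ring
    have h0 : φ ⟨x, y⟩ = 0 := by
      rw [hφdef, Zsqrtd.lift_apply_apply]
      rw [(CharP.intCast_eq_zero_iff F p x).2 hpx, (CharP.intCast_eq_zero_iff F p y).2 hpy]
      ring
    rw [← hxy, map_sum] at h0
    have hterm : ∀ s : K, φ (χ (2⁻¹ + algebraMap K F s * δ)) =
        (2⁻¹ ^ 2 + (-δ ^ 2) * (algebraMap K F s) ^ 2) ^ (3 * a) := by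
      intro s
      rw [hφ _ (hne s)]
      have h5 : 2⁻¹ ^ 2 + (-δ ^ 2) * (algebraMap K F s) ^ 2 =
          (2⁻¹ + algebraMap K F s * δ) * (2⁻¹ + algebraMap K F s * δ) ^ (Fintype.card K) := by
        rw [hpow, map_neg]
        ring
      rw [h5, ← pow_succ', ha, ← pow_mul]
      congr 1
      ring
    rw [Finset.sum_congr rfl fun s _ => hterm s, sum_add_mul_sq_pow ha.symm] at h0
    have hch : ((3 * a).choose a : F) ≠ 0 := by
      rw [Ne, CharP.cast_eq_zero_iff F p]
      exact not_dvd_choose_three_mul hp hp4 (2 * t) a (by rw [← ha, hK])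
    have h6 : (2⁻¹ : F) ≠ 0 := inv_ne_zero h2
    have h7 : (-δ ^ 2 : F) ≠ 0 := by simpa using hδ0
    exact (neg_ne_zero.2 (mul_ne_zero hch (mul_ne_zero (pow_ne_zero _ (pow_ne_zero _ h6))
      (pow_ne_zero _ h7)))) h0

theorem exists_gaussSum_quartic {K₀ : Type*} [Field K₀] [Fintype K₀] [Algebra K₀ K]
    {p t : ℕ} [Fact p.Prime] [Algebra (ZMod p) F] (hp4 : p % 4 = 1) (ht : 0 < t)
    (hK₀ : Fintype.card K₀ = p ^ t)
    (hK : Fintype.card K = p ^ (2 * t)) (hF : Fintype.card F = p ^ (4 * t)) {g : F} (hg0 : g ≠ 0)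
    (hg : ∀ x : F, x ≠ 0 → ∃ j : ℕ, g ^ j = x) {χ : MulChar F GaussianInt} (hχ : χ g = ⟨0, 1⟩)
    (ψ₀ : AddChar K₀ ℂ) (hψ₀ : ψ₀ ≠ 1) (ψ : AddChar F ℂ)
    (hψ : ∀ x, ψ x = ψ₀ (Algebra.trace K₀ K (Algebra.trace K F x))) :
    ∃ x y : ℤ, x ^ 2 + y ^ 2 = (p : ℤ) ^ (2 * t) ∧ x ≡ 1 [ZMOD 4] ∧ 2 ∣ y ∧ ¬ (p : ℤ) ∣ x ∧
      gaussSum (χ.ringHomComp GaussianInt.toComplex) ψ = -(p : ℂ) ^ t * (x + y * Complex.I) ∧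
      gaussSum (χ.ringHomComp GaussianInt.toComplex ^ 2) ψ = -(p : ℂ) ^ (2 * t) ∧
      gaussSum (χ.ringHomComp GaussianInt.toComplex ^ 3) ψ =
        -(p : ℂ) ^ t * (x - y * Complex.I) := by
  classical
  have hp : p.Prime := Fact.out
  have hFK : Fintype.card F = Fintype.card K ^ 2 := by
    rw [hF, hK, ← pow_mul]
    congr 1
    ring
  have hKK : Fintype.card K = Fintype.card K₀ ^ 2 := by
    rw [hK, hK₀, ← pow_mul]
    congr 1
    ring
  have hmod : ∀ s, p ^ s % 4 = 1 := by
    intro s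
    rw [Nat.pow_mod, hp4]
    simp
  have hK4 : Fintype.card K % 4 = 1 := by rw [hK, hmod]
  have hK₀4 : Fintype.card K₀ % 4 = 1 := by rw [hK₀, hmod]
  set χc : MulChar F ℂ := χ.ringHomComp GaussianInt.toComplex with hχc
  set ψK : AddChar K ℂ := ψ₀.compAddMonoidHom (Algebra.trace K₀ K : K →+ K₀) with hψK
  have hψF : ψ = ψK.compAddMonoidHom (Algebra.trace K F : F →+ K) := by
    ext x
    rw [hψ]
    rfl
  have hψK1 : ψK ≠ 1 := by
    intro h1
    apply hψ₀
    ext z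
    obtain ⟨w, rfl⟩ := Algebra.trace_surjective K₀ K z
    exact DFunLike.congr_fun h1 w
  have hχcg : χc g = Complex.I := by
    rw [hχc, MulChar.ringHomComp_apply, hχ, GaussianInt.toComplex_def']
    simp
  obtain ⟨w, hw0, hw, e, hwe⟩ := exists_generator_baseRestrict hFK hK4 hg0 hg
  have hwχ : χc (algebraMap K F w) = -1 := by
    rw [hwe, map_pow, hχcg, pow_add, pow_mul, Complex.I_pow_four, one_pow, one_mul, Complex.I_sq]
  have hodd : ∀ ξ : MulChar F ℂ, ξ (algebraMap K F w) = -1 → gaussSum ξ ψ = -(p : ℂ) ^ t *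
      ∑ z ∈ Finset.univ.filter (fun z : F => Algebra.trace K F z = 1), ξ z := by
    intro ξ hξ
    have hb : ξ.baseRestrict K w = -1 := hξ
    rw [hψF, gaussSum_eq_gaussSum_baseRestrict_mul, hψK,
      gaussSum_eq_neg_card_of_generator hKK hK₀4 hw0 hw _ hb _ hψ₀, hK₀]
    · push_cast
      rfl
    · intro h1
      rw [h1, MulChar.one_apply (by simpa using hw0)] at hb
      norm_num at hb
  obtain ⟨x, y, hxy⟩ : ∃ x y : ℤ,
      ∑ z ∈ Finset.univ.filter (fun z : F => Algebra.trace K F z = 1), χ z = ⟨x, y⟩ := ⟨_, _, rfl⟩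
  obtain ⟨hmod4, hy2, hpxy⟩ := sum_trace_eq_one_congr hp4 hK hF hg0 hg hχ hxy
  have hG1 : gaussSum χc ψ = -(p : ℂ) ^ t * (x + y * Complex.I) := by
    rw [hodd χc hwχ, ← GaussianInt.toComplex_def', ← hxy, map_sum]
    rfl
  have hG2 : gaussSum (χc ^ 2) ψ = -(p : ℂ) ^ (2 * t) := by
    rw [hψF, gaussSum_eq_neg_card_of_generator hFK hK4 hg0 hg (χc ^ 2)
      (by rw [MulChar.pow_apply' _ two_ne_zero, hχcg, Complex.I_sq]) ψK hψK1, hK]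
    push_cast
    rfl
  have hG3 : gaussSum (χc ^ 3) ψ = -(p : ℂ) ^ t * (x - y * Complex.I) := by
    rw [hodd (χc ^ 3) (by rw [MulChar.pow_apply' _ three_ne_zero, hwχ]; norm_num)]
    congr 1
    have hconj : (x - y * Complex.I : ℂ) = (starRingEnd ℂ) (x + y * Complex.I) := by
      simp [sub_eq_add_neg]
    rw [hconj, ← GaussianInt.toComplex_def', ← hxy, map_sum, map_sum]
    refine Finset.sum_congr rfl fun z hz => ?_
    have hz0 : z ≠ 0 := by
      rintro rfl
      have := (Finset.mem_filter.1 hz).2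
      rw [map_zero] at this
      exact zero_ne_one this
    obtain ⟨j, rfl⟩ := hg z hz0
    rw [MulChar.pow_apply' _ three_ne_zero, map_pow, hχcg, map_pow, hχ, map_pow, map_pow,
      GaussianInt.toComplex_def']
    rw [← pow_mul, mul_comm, pow_mul, Complex.I_pow_three]
    simp
  have hppos : (0 : ℤ) < (p : ℤ) ^ (2 * t) := pow_pos (by exact_mod_cast hp.pos) _
  have hnorm : x ^ 2 + y ^ 2 = (p : ℤ) ^ (2 * t) := by
    have hχ1 : χc ≠ 1 := by
      intro h1
      rw [h1, MulChar.one_apply (by simpa using hg0)] at hχcg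
      have := congrArg Complex.re hχcg
      simp at this
    have hψ1 : ψ ≠ 1 := by
      intro h1
      apply hψK1
      ext z
      obtain ⟨v, rfl⟩ := Algebra.trace_surjective K F z
      rw [hψF] at h1
      exact DFunLike.congr_fun h1 v
    have hm := gaussSum_mul_gaussSum_eq_card hχ1 (AddChar.IsPrimitive.of_ne_one hψ1)
    rw [← star_gaussSum_eq, hG1, hF] at hm
    have hm' : (p : ℂ) ^ (2 * t) * ((x : ℂ) ^ 2 + (y : ℂ) ^ 2) =
        (p : ℂ) ^ (2 * t) * (p : ℂ) ^ (2 * t) := by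
      simp only [star_mul', star_neg, star_pow, star_add, star_natCast, star_intCast] at hm
      rw [show star Complex.I = -Complex.I from Complex.conj_I] at hm
      push_cast at hm
      have e1 : (p : ℂ) ^ (4 * t) = (p : ℂ) ^ (2 * t) * (p : ℂ) ^ (2 * t) := by ring
      rw [← e1, ← hm]
      linear_combination (p : ℂ) ^ (2 * t) * (y : ℂ) ^ 2 * Complex.I_sq
    have hm'' : (p : ℤ) ^ (2 * t) * (x ^ 2 + y ^ 2) = (p : ℤ) ^ (2 * t) * (p : ℤ) ^ (2 * t) := by
      exact_mod_cast hm'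
    exact mul_left_cancel₀ hppos.ne' hm''
  refine ⟨x, y, hnorm, ?_, Int.dvd_of_emod_eq_zero hy2, ?_, hG1, hG2, hG3⟩
  · obtain ⟨d, hd⟩ : ∃ d : ℕ, p ^ t = 4 * d + 1 := ⟨p ^ t / 4, by have := hmod t; omega⟩
    have hP : (p : ℤ) ^ (2 * t) = 8 * (2 * (d : ℤ) ^ 2 + d) + 1 := by
      have : (p : ℤ) ^ (2 * t) = ((p : ℤ) ^ t) ^ 2 := by rw [← pow_mul, mul_comm]
      rw [this, show (p : ℤ) ^ t = 4 * d + 1 by exact_mod_cast hd]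
      ring
    rw [hP] at hnorm
    obtain ⟨f, rfl⟩ : ∃ f, y = 2 * f := ⟨y / 2, by omega⟩
    unfold Int.ModEq
    rcases Int.even_or_odd' f with ⟨f', rfl | rfl⟩
    · omega
    · exfalso
      obtain ⟨x', rfl⟩ : ∃ x', x = 4 * x' + 3 := ⟨x / 4, by omega⟩
      have : 8 * (2 * x' ^ 2 + 3 * x' + 2 * (f' ^ 2 + f') + 1 - 2 * (d : ℤ) ^ 2 - d) = -4 := by
        linear_combination hnorm
      omega
  · intro hpx
    apply hpxy
    refine ⟨hpx, ?_⟩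
    have hd : (p : ℤ) ∣ y ^ 2 := by
      have h1 : (p : ℤ) ∣ (p : ℤ) ^ (2 * t) := dvd_pow_self _ (by omega)
      rw [← hnorm] at h1
      exact (dvd_add_right (dvd_pow hpx two_ne_zero)).1 h1
    exact (Nat.prime_iff_prime_int.mp hp).dvd_of_dvd_pow hd

end QuarticGaussSum

section PeriodWeight

variable {F : Type*} [Field F] [Fintype F]

theorem one_add_four_mul_sum_addChar {g : F} (hg0 : g ≠ 0)
    (hg : ∀ x : F, x ≠ 0 → ∃ j : ℕ, g ^ j = x) {c : ℕ} (hc : 4 * c = Fintype.card F - 1)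
    {χ : MulChar F ℂ} (hχ : χ g = Complex.I) {ψ : AddChar F ℂ} (hψ : ψ ≠ 1) {β : F} (hβ : β ≠ 0) :
    1 + 4 * ∑ i ∈ Finset.range c, ψ (β * g ^ (4 * i)) =
      χ β ^ 3 * gaussSum χ ψ + χ β ^ 2 * gaussSum (χ ^ 2) ψ + χ β * gaussSum (χ ^ 3) ψ := by
  classical
  have hχβ : χ β ^ 4 = 1 := by
    obtain ⟨j, rfl⟩ := hg β hβ
    rw [map_pow, hχ, ← pow_mul, mul_comm, pow_mul, Complex.I_pow_four, one_pow]
  have hshift : ∀ ξ : MulChar F ℂ, ξ β * ∑ x, ξ x * ψ (β * x) = gaussSum ξ ψ := fun ξ =>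
    gaussSum_mulShift ξ ψ (Units.mk0 β hβ)
  have h1 := hshift χ
  have h2 := hshift (χ ^ 2)
  have h3 := hshift (χ ^ 3)
  have h0 : ∑ x, ψ (β * x) = 0 := by
    have := AddChar.sum_mulShift β (AddChar.IsPrimitive.of_ne_one hψ)
    rw [if_neg hβ] at this
    simpa [mul_comm] using this
  rw [MulChar.pow_apply' _ two_ne_zero] at h2
  rw [MulChar.pow_apply' _ three_ne_zero] at h3
  have key := sum_eq_add_sum_range_four hg0 hg hc
    (fun x => ψ (β * x) + χ x * ψ (β * x) + (χ ^ 2) x * ψ (β * x) + (χ ^ 3) x * ψ (β * x))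
  have hterm : ∀ i, (fun x => ψ (β * x) + χ x * ψ (β * x) + (χ ^ 2) x * ψ (β * x) +
      (χ ^ 3) x * ψ (β * x)) (g ^ i) = (1 + Complex.I ^ i + (Complex.I ^ i) ^ 2 +
        (Complex.I ^ i) ^ 3) * ψ (β * g ^ i) := by
    intro i
    simp only [MulChar.pow_apply' _ two_ne_zero, MulChar.pow_apply' _ three_ne_zero, map_pow, hχ]
    ring
  simp only [hterm] at key
  have hI : ∀ i, Complex.I ^ (4 * i) = 1 := fun i => by
    rw [pow_mul, Complex.I_pow_four, one_pow]
  have hI2 : Complex.I ^ 2 = -1 := Complex.I_sq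
  have e1 : 1 + Complex.I + Complex.I ^ 2 + Complex.I ^ 3 = 0 := by
    rw [Complex.I_pow_three, hI2]
    ring
  have e2 : 1 + Complex.I ^ 2 + (Complex.I ^ 2) ^ 2 + (Complex.I ^ 2) ^ 3 = 0 := by
    rw [hI2]
    ring
  have e3 : 1 + Complex.I ^ 3 + (Complex.I ^ 3) ^ 2 + (Complex.I ^ 3) ^ 3 = 0 := by
    rw [Complex.I_pow_three]
    linear_combination (1 - Complex.I) * hI2
  simp only [pow_add, hI, one_mul, pow_one, e1, e2, e3, zero_mul, add_zero, one_pow] at key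
  rw [Finset.sum_add_distrib, Finset.sum_add_distrib, Finset.sum_add_distrib, h0,
    ← Finset.mul_sum] at key
  rw [MulChar.map_zero, MulChar.map_zero, MulChar.map_zero, mul_zero, AddChar.map_zero_eq_one]
    at key
  rw [← h1, ← h2, ← h3]
  linear_combination -key - (∑ x, χ x * ψ (β * x) + ∑ x, (χ ^ 2) x * ψ (β * x) +
    ∑ x, (χ ^ 3) x * ψ (β * x)) * hχβ

theorem four_mul_card_trace_ne_zero {p : ℕ} [Fact p.Prime] [Algebra (ZMod p) F] {g : F}
    (hg0 : g ≠ 0) (hg : ∀ x : F, x ≠ 0 → ∃ j : ℕ, g ^ j = x) {c : ℕ}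
    (hc : 4 * c = Fintype.card F - 1) {χ : MulChar F ℂ} (hχ : χ g = Complex.I)
    (hχp : ∀ y : ZMod p, y ≠ 0 → χ (algebraMap (ZMod p) F y) = 1) {ψ : AddChar F ℂ}
    (hψ : ∀ x, ψ x = ZMod.stdAddChar (Algebra.trace (ZMod p) F x)) {β : F} (hβ : β ≠ 0) :
    4 * (p : ℂ) *
        ((Finset.range c).filter fun i => Algebra.trace (ZMod p) F (β * g ^ (4 * i)) ≠ 0).card =
      ((p : ℂ) - 1) * (Fintype.card F - (χ β ^ 3 * gaussSum χ ψ + χ β ^ 2 * gaussSum (χ ^ 2) ψ +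
        χ β * gaussSum (χ ^ 3) ψ)) := by
  classical
  have hp : p.Prime := Fact.out
  set u : ℕ → ZMod p := fun i => Algebra.trace (ZMod p) F (β * g ^ (4 * i)) with hu
  have hψ1 : ψ ≠ 1 := by
    intro h1
    apply ZMod.isPrimitive_stdAddChar p one_ne_zero
    rw [AddChar.mulShift_one]
    ext y
    obtain ⟨x, rfl⟩ := Algebra.trace_surjective (ZMod p) F y
    rw [← hψ, h1]
    rfl
  have hcard : (Fintype.card F : ℂ) = 4 * c + 1 := by
    have := Fintype.one_lt_card (α := F)
    have h : Fintype.card F = 4 * c + 1 := by omega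
    rw [h]
    push_cast
    rfl
  have hsum1 : ∑ i ∈ Finset.range c, ∑ y : ZMod p, (ZMod.stdAddChar (y * u i) : ℂ) =
      p * (c - ((Finset.range c).filter fun i => u i ≠ 0).card) := by
    have hf := Finset.card_filter_add_card_filter_not (s := Finset.range c) (fun i => u i = 0)
    rw [Finset.card_range] at hf
    have hf' : (c : ℂ) = (((Finset.range c).filter fun i => u i = 0).card : ℂ) +
        (((Finset.range c).filter fun i => u i ≠ 0).card : ℂ) := by exact_mod_cast hf.symm
    rw [hf', add_sub_cancel_right]
    simp only [AddChar.sum_mulShift _ (ZMod.isPrimitive_stdAddChar p), ZMod.card]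
    rw [← Nat.cast_sum, Finset.sum_ite, Finset.sum_const]
    simp [mul_comm]
  have hsum2 : ∑ i ∈ Finset.range c, ∑ y : ZMod p, (ZMod.stdAddChar (y * u i) : ℂ) =
      c + ((p : ℂ) - 1) * ∑ i ∈ Finset.range c, ψ (β * g ^ (4 * i)) := by
    rw [Finset.sum_comm, ← Finset.add_sum_erase _ _ (Finset.mem_univ (0 : ZMod p))]
    congr 1
    · simp
    · have : ∀ y ∈ Finset.univ.erase (0 : ZMod p),
          ∑ i ∈ Finset.range c, (ZMod.stdAddChar (y * u i) : ℂ) =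
            ∑ i ∈ Finset.range c, ψ (β * g ^ (4 * i)) := by
        intro y hy
        have hy0 : y ≠ 0 := Finset.ne_of_mem_erase hy
        have hy0' : algebraMap (ZMod p) F y ≠ 0 := by simpa using hy0
        have ha := one_add_four_mul_sum_addChar hg0 hg hc hχ hψ1 hβ
        have hb := one_add_four_mul_sum_addChar hg0 hg hc hχ hψ1 (mul_ne_zero hy0' hβ)
        rw [map_mul, hχp y hy0, one_mul, ← ha] at hb
        have hb' := mul_left_cancel₀ (by norm_num : (4 : ℂ) ≠ 0) (add_left_cancel hb)
        rw [← hb']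
        refine Finset.sum_congr rfl fun i _ => ?_
        rw [hψ, mul_assoc, ← Algebra.smul_def, map_smul, smul_eq_mul]
      rw [Finset.sum_congr rfl this, Finset.sum_const, Finset.card_erase_of_mem (Finset.mem_univ _),
        Finset.card_univ, ZMod.card, nsmul_eq_mul, Nat.cast_sub hp.one_le, Nat.cast_one]
  rw [← one_add_four_mul_sum_addChar hg0 hg hc hχ hψ1 hβ, hcard]
  linear_combination 4 * (hsum1 - hsum2)

end PeriodWeight

section QuarticWeight

variable {F : Type} [Field F] [Fintype F]

/-- The number of nonzero traces among `β, β g^4, …, β g^(4(c-1))`. -/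
noncomputable def periodWeight (p : ℕ) [Algebra (ZMod p) F] (g : F) (c : ℕ) (β : F) : ℕ :=
  ((Finset.range c).filter fun i => Algebra.trace (ZMod p) F (β * g ^ (4 * i)) ≠ 0).card

theorem exists_quartic_mulChar {c : ℕ} (hc : 4 * c = Fintype.card F - 1) {g : F} (hg0 : g ≠ 0)
    (hg : ∀ x : F, x ≠ 0 → ∃ j : ℕ, g ^ j = x) : ∃ χ : MulChar F GaussianInt, χ g = ⟨0, 1⟩ := by
  classical
  have hI : IsUnit (⟨0, 1⟩ : GaussianInt) := IsUnit.of_mul_eq_one (⟨0, -1⟩ : GaussianInt) rfl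
  have hζ : hI.unit ∈ rootsOfUnity (Fintype.card Fˣ) GaussianInt := by
    rw [mem_rootsOfUnity', IsUnit.unit_spec, Fintype.card_units, ← hc, pow_mul,
      show (⟨0, 1⟩ : GaussianInt) ^ 4 = 1 from rfl, one_pow]
  have hgen : ∀ x : Fˣ, x ∈ Subgroup.zpowers (Units.mk0 g hg0) := by
    intro x
    obtain ⟨j, hj⟩ := hg x x.ne_zero
    exact ⟨j, Units.ext (by simpa using hj)⟩
  exact ⟨MulChar.ofRootOfUnity hζ hgen, MulChar.ofRootOfUnity_spec hζ hgen⟩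

theorem exists_four_mul_periodWeight {p t : ℕ} [Fact p.Prime] [Algebra (ZMod p) F]
    (hp4 : p % 4 = 1) (ht : 0 < t) (hF : Fintype.card F = p ^ (4 * t)) {g : F} (hg0 : g ≠ 0)
    (hg : ∀ x : F, x ≠ 0 → ∃ j : ℕ, g ^ j = x) {c : ℕ} (hc : 4 * c = Fintype.card F - 1) :
    ∃ x y : ℤ, x ^ 2 + y ^ 2 = (p : ℤ) ^ (2 * t) ∧ x ≡ 1 [ZMOD 4] ∧ 2 ∣ y ∧ ¬ (p : ℤ) ∣ x ∧
      ∀ i, 4 * (p : ℤ) * periodWeight p g c (g ^ (4 * i)) =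
          ((p : ℤ) - 1) * ((p : ℤ) ^ (4 * t) + (p : ℤ) ^ (2 * t) + 2 * x * (p : ℤ) ^ t) ∧
        4 * (p : ℤ) * periodWeight p g c (g ^ (4 * i + 1)) =
          ((p : ℤ) - 1) * ((p : ℤ) ^ (4 * t) - (p : ℤ) ^ (2 * t) + 2 * y * (p : ℤ) ^ t) ∧
        4 * (p : ℤ) * periodWeight p g c (g ^ (4 * i + 2)) =
          ((p : ℤ) - 1) * ((p : ℤ) ^ (4 * t) + (p : ℤ) ^ (2 * t) - 2 * x * (p : ℤ) ^ t) ∧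
        4 * (p : ℤ) * periodWeight p g c (g ^ (4 * i + 3)) =
          ((p : ℤ) - 1) * ((p : ℤ) ^ (4 * t) - (p : ℤ) ^ (2 * t) - 2 * y * (p : ℤ) ^ t) := by
  classical
  have hp : p.Prime := Fact.out
  obtain ⟨χ, hχ⟩ := exists_quartic_mulChar hc hg0 hg
  have hfF : Module.finrank (ZMod p) F = 4 * t := by
    have := Module.card_eq_pow_finrank (K := ZMod p) (V := F)
    rw [hF, ZMod.card] at this
    exact (Nat.pow_right_injective hp.two_le this).symm
  obtain ⟨iF⟩ := FiniteField.nonempty_algHom_of_finrank_dvd (F := ZMod p)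
    (K := GaloisField p (2 * t)) (L := F)
    (by rw [GaloisField.finrank p (by omega), hfF]; exact ⟨2, by ring⟩)
  obtain ⟨iK⟩ := FiniteField.nonempty_algHom_of_finrank_dvd (F := ZMod p)
    (K := GaloisField p t) (L := GaloisField p (2 * t))
    (by rw [GaloisField.finrank p (by omega), GaloisField.finrank p (by omega)]; exact ⟨2, by ring⟩)
  let _ := Fintype.ofFinite (GaloisField p (2 * t))
  let _ := Fintype.ofFinite (GaloisField p t)
  let _ : Algebra (GaloisField p (2 * t)) F := iF.toRingHom.toAlgebra
  let _ : Algebra (GaloisField p t) (GaloisField p (2 * t)) := iK.toRingHom.toAlgebra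
  have _ : IsScalarTower (ZMod p) (GaloisField p (2 * t)) F :=
    IsScalarTower.of_algebraMap_eq fun x => (iF.commutes x).symm
  have _ : IsScalarTower (ZMod p) (GaloisField p t) (GaloisField p (2 * t)) :=
    IsScalarTower.of_algebraMap_eq fun x => (iK.commutes x).symm
  have hK : Fintype.card (GaloisField p (2 * t)) = p ^ (2 * t) := by
    rw [← Nat.card_eq_fintype_card, GaloisField.card p _ (by omega)]
  have hK₀ : Fintype.card (GaloisField p t) = p ^ t := by
    rw [← Nat.card_eq_fintype_card, GaloisField.card p _ (by omega)]
  set ψ₀ : AddChar (GaloisField p t) ℂ := (ZMod.stdAddChar (N := p)).compAddMonoidHom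
    (Algebra.trace (ZMod p) (GaloisField p t) : GaloisField p t →+ ZMod p) with hψ₀
  set ψ : AddChar F ℂ := (ZMod.stdAddChar (N := p)).compAddMonoidHom
    (Algebra.trace (ZMod p) F : F →+ ZMod p) with hψ
  have hψ₀1 : ψ₀ ≠ 1 := by
    intro h1
    apply ZMod.isPrimitive_stdAddChar p one_ne_zero
    rw [AddChar.mulShift_one]
    ext y
    obtain ⟨x, rfl⟩ := Algebra.trace_surjective (ZMod p) (GaloisField p t) y
    exact DFunLike.congr_fun h1 x
  have hψψ₀ : ∀ x, ψ x = ψ₀ (Algebra.trace (GaloisField p t) (GaloisField p (2 * t))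
      (Algebra.trace (GaloisField p (2 * t)) F x)) := by
    intro x
    change ZMod.stdAddChar (Algebra.trace (ZMod p) F x) =
      ZMod.stdAddChar (Algebra.trace (ZMod p) (GaloisField p t) _)
    rw [Algebra.trace_trace, Algebra.trace_trace]
  obtain ⟨x, y, hxy, hx, hy, hpx, hG1, hG2, hG3⟩ :=
    exists_gaussSum_quartic hp4 ht hK₀ hK hF hg0 hg hχ ψ₀ hψ₀1 ψ hψψ₀
  set χc : MulChar F ℂ := χ.ringHomComp GaussianInt.toComplex with hχc
  have hχcg : χc g = Complex.I := by
    rw [hχc, MulChar.ringHomComp_apply, hχ, GaussianInt.toComplex_def']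
    simp
  have hχp : ∀ z : ZMod p, z ≠ 0 → χc (algebraMap (ZMod p) F z) = 1 := by
    intro z hz
    rw [hχc, MulChar.ringHomComp_apply, quartic_apply_eq_one_of_pow_eq_one hp.one_lt hp4 hF hg0 hg
      hχ (by rw [← map_pow, ZMod.pow_card_sub_one_eq_one hz, map_one]), map_one]
  have key : ∀ j, 4 * (p : ℂ) * periodWeight p g c (g ^ j) = ((p : ℂ) - 1) * ((p : ℂ) ^ (4 * t) +
      ((Complex.I ^ j) ^ 3 * ((p : ℂ) ^ t * (x + y * Complex.I)) +
        (Complex.I ^ j) ^ 2 * (p : ℂ) ^ (2 * t) +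
        Complex.I ^ j * ((p : ℂ) ^ t * (x - y * Complex.I)))) := by
    intro j
    rw [periodWeight, four_mul_card_trace_ne_zero hg0 hg hc hχcg hχp (ψ := ψ)
      (fun _ => rfl) (pow_ne_zero j hg0), map_pow, hχcg, hG1, hG2, hG3, hF]
    push_cast
    ring
  have hI : ∀ i, Complex.I ^ (4 * i) = 1 := fun i => by
    rw [pow_mul, Complex.I_pow_four, one_pow]
  have hI2 : Complex.I ^ 2 = -1 := Complex.I_sq
  refine ⟨x, y, hxy, hx, hy, hpx, fun i => ⟨?_, ?_, ?_, ?_⟩⟩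
  · have h := key (4 * i)
    rw [hI] at h
    rw [← Int.cast_inj (α := ℂ)]
    push_cast
    rw [h]
    ring
  · have h := key (4 * i + 1)
    rw [pow_add Complex.I, hI, one_mul, pow_one] at h
    rw [← Int.cast_inj (α := ℂ)]
    push_cast
    rw [h, Complex.I_pow_three]
    linear_combination ((p : ℂ) - 1) * ((p : ℂ) ^ (2 * t) - 2 * y * (p : ℂ) ^ t) * hI2
  · have h := key (4 * i + 2)
    rw [pow_add Complex.I, hI, one_mul, hI2] at h
    rw [← Int.cast_inj (α := ℂ)]
    push_cast
    rw [h]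
    ring
  · have h := key (4 * i + 3)
    rw [pow_add Complex.I, hI, one_mul, Complex.I_pow_three] at h
    rw [← Int.cast_inj (α := ℂ)]
    push_cast
    rw [h]
    linear_combination ((p : ℂ) - 1) * ((p : ℂ) ^ (2 * t) + y * (p : ℂ) ^ t -
      (p : ℂ) ^ t * x * Complex.I - y * (p : ℂ) ^ t * (Complex.I ^ 2 - 1)) * hI2

theorem exists_quartic_weights {p t : ℕ} [Fact p.Prime] [Algebra (ZMod p) F]
    (hp4 : p % 4 = 1) (ht : 0 < t) (hF : Fintype.card F = p ^ (4 * t)) {g : F} (hg0 : g ≠ 0)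
    (hg : ∀ x : F, x ≠ 0 → ∃ j : ℕ, g ^ j = x) {c : ℕ} (hc : 4 * c = Fintype.card F - 1)
    {A B : ℤ} (hAB : (p : ℤ) ^ (2 * t) = A ^ 2 + 4 * B ^ 2) (hA1 : A ≡ 1 [ZMOD 4])
    (hAp : Int.gcd A (p : ℤ) = 1) :
    ∃ w : Fin 4 → ℕ, (∀ s, 0 < w s) ∧
      (∀ ℓ1 ℓ2 ℓ3 ℓ4 : ℕ, quarticWeight p t (4 * t) A B ℓ1 ℓ2 ℓ3 ℓ4 =
        ((ℓ1 * w 0 + ℓ2 * w 1 + ℓ3 * w 2 + ℓ4 * w 3 : ℕ) : ℚ)) ∧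
      (∀ j, ∃ s, periodWeight p g c (g ^ j) = w s) ∧
      ∀ {M : Type} [AddCommMonoid M] (f : ℕ → M),
        ∑ β : F, f (periodWeight p g c β) = f 0 + c • ∑ s, f (w s) := by
  have hp : p.Prime := Fact.out
  have hp5 : 5 ≤ p := by
    have := hp.two_le
    omega
  obtain ⟨x, y, hxy, hx, hy, hpx, hw⟩ := exists_four_mul_periodWeight hp4 ht hF hg0 hg hc
  have hppos : (0 : ℤ) < p := by exact_mod_cast hp.pos
  have hP5 : (5 : ℤ) ≤ (p : ℤ) ^ t := by
    have h1 : p ≤ p ^ t := Nat.le_self_pow ht.ne' p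
    exact_mod_cast hp5.trans h1
  have hQ : (p : ℤ) ^ (2 * t) = ((p : ℤ) ^ t) ^ 2 := by rw [← pow_mul, mul_comm]
  have hq : (p : ℤ) ^ (4 * t) = ((p : ℤ) ^ t) ^ 4 := by rw [← pow_mul, mul_comm]
  have hpA : ¬ (p : ℤ) ∣ A := by
    intro h
    have h1 := Int.dvd_coe_gcd h (dvd_refl (p : ℤ))
    rw [hAp] at h1
    have := Int.le_of_dvd one_pos h1
    omega
  have hp2 : ¬ (p : ℤ) ∣ 2 := by
    intro h
    have := Int.le_of_dvd two_pos h
    omega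
  have hmod : (p : ℤ) ^ (2 * t) ≡ 1 [ZMOD 4] := by
    have h1 : (p : ℤ) ≡ 1 [ZMOD 4] := by
      unfold Int.ModEq
      omega
    simpa using h1.pow (2 * t)
  obtain ⟨hxA, hyB⟩ := eq_of_sq_add_sq_eq_prime_pow hp hmod hxy hAB hx hA1 hy hp2 hpx hpA
  have hbound : ∀ z : ℤ, z ^ 2 ≤ ((p : ℤ) ^ t) ^ 2 →
      2 * z * (p : ℤ) ^ t ≤ 2 * ((p : ℤ) ^ t) ^ 2 ∧ -(2 * ((p : ℤ) ^ t) ^ 2) ≤ 2 * z * (p : ℤ) ^ t := by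
    intro z hz
    obtain ⟨h1, h2⟩ := abs_le_of_sq_le_sq' hz (by linarith)
    constructor <;> nlinarith
  have hpos4 : 3 * ((p : ℤ) ^ t) ^ 2 < ((p : ℤ) ^ t) ^ 4 := by
    have h25 : 25 ≤ ((p : ℤ) ^ t) ^ 2 := by nlinarith
    nlinarith
  obtain ⟨hx1, hx2⟩ := hbound x (by rw [← hQ, ← hxy]; linarith [sq_nonneg y])
  obtain ⟨hy1, hy2⟩ := hbound y (by rw [← hQ, ← hxy]; linarith [sq_nonneg x])
  have hpos : ∀ (j : ℕ) (v : ℤ), 4 * (p : ℤ) * periodWeight p g c (g ^ j) = ((p : ℤ) - 1) * v →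
      0 < v → 0 < periodWeight p g c (g ^ j) := by
    intro j v h hv
    by_contra h0
    rw [Nat.eq_zero_of_not_pos h0] at h
    have : 0 < ((p : ℤ) - 1) * v := mul_pos (by omega) hv
    rw [← h] at this
    simp at this
  have heq : ∀ (j k : ℕ) (v : ℤ), 4 * (p : ℤ) * periodWeight p g c (g ^ j) = v →
      4 * (p : ℤ) * periodWeight p g c (g ^ k) = v →
      periodWeight p g c (g ^ j) = periodWeight p g c (g ^ k) := by
    intro j k v h1 h2
    have := mul_left_cancel₀ (by positivity) (h1.trans h2.symm)
    exact_mod_cast this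
  set u : Fin 4 → ℕ := fun s => periodWeight p g c (g ^ (s : ℕ)) with hu
  have h0 := hw 0
  simp only [mul_zero, zero_add] at h0
  have hu0 : ∀ i, periodWeight p g c (g ^ (4 * i)) = u 0 := fun i => heq _ 0 _ (hw i).1 h0.1
  have hu1 : ∀ i, periodWeight p g c (g ^ (4 * i + 1)) = u 1 := fun i =>
    heq _ 1 _ (hw i).2.1 h0.2.1
  have hu2 : ∀ i, periodWeight p g c (g ^ (4 * i + 2)) = u 2 := fun i =>
    heq _ 2 _ (hw i).2.2.1 h0.2.2.1
  have hu3 : ∀ i, periodWeight p g c (g ^ (4 * i + 3)) = u 3 := fun i =>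
    heq _ 3 _ (hw i).2.2.2 h0.2.2.2
  have hupos : ∀ s, 0 < u s := by
    intro s
    rw [hQ, hq] at h0
    have a0 : 0 < u 0 := hpos 0 _ h0.1 (by linarith)
    have a1 : 0 < u 1 := hpos 1 _ h0.2.1 (by linarith)
    have a2 : 0 < u 2 := hpos 2 _ h0.2.2.1 (by linarith)
    have a3 : 0 < u 3 := hpos 3 _ h0.2.2.2 (by linarith)
    fin_cases s <;> assumption
  have hsum : ∀ {M : Type} [AddCommMonoid M] (f : ℕ → M),
      ∑ β : F, f (periodWeight p g c β) = f 0 + c • (f (u 0) + f (u 2) + f (u 1) + f (u 3)) := by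
    intro M _ f
    rw [sum_eq_add_sum_range_four hg0 hg hc]
    simp only [hu0, hu1, hu2, hu3]
    rw [Finset.sum_const, Finset.card_range, add_right_comm (f (u 0))]
    congr 2
    simp [periodWeight]
  have hmem : ∀ j, ∃ s, periodWeight p g c (g ^ j) = u s := by
    intro j
    obtain ⟨i, hi⟩ : ∃ i, j = 4 * i ∨ j = 4 * i + 1 ∨ j = 4 * i + 2 ∨ j = 4 * i + 3 :=
      ⟨j / 4, by omega⟩
    rcases hi with rfl | rfl | rfl | rfl
    · exact ⟨0, hu0 i⟩
    · exact ⟨1, hu1 i⟩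
    · exact ⟨2, hu2 i⟩
    · exact ⟨3, hu3 i⟩
  have hp0 : (p : ℚ) ≠ 0 := by exact_mod_cast hp.ne_zero
  obtain ⟨k0, k1, k2, k3⟩ := h0
  have cast : ∀ (j : ℕ) (v : ℤ), 4 * (p : ℤ) * periodWeight p g c (g ^ j) = ((p : ℤ) - 1) * v →
      (periodWeight p g c (g ^ j) : ℚ) = ((p : ℚ) - 1) / (4 * p) * (v : ℚ) := by
    intro j v h
    have h' : 4 * (p : ℚ) * periodWeight p g c (g ^ j) = ((p : ℚ) - 1) * v := by exact_mod_cast h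
    field_simp
    linear_combination h'
  have q0 : (u 0 : ℚ) = _ := cast 0 _ k0
  have q1 : (u 1 : ℚ) = _ := cast 1 _ k1
  have q2 : (u 2 : ℚ) = _ := cast 2 _ k2
  have q3 : (u 3 : ℚ) = _ := cast 3 _ k3
  subst hxA
  rcases hyB with rfl | rfl
  · refine ⟨![u 0, u 2, u 1, u 3], ?_, ?_, ?_, ?_⟩
    · intro s
      fin_cases s <;> apply hupos
    · intro ℓ1 ℓ2 ℓ3 ℓ4
      simp only [Matrix.cons_val]
      push_cast
      rw [q0, q1, q2, q3, quarticWeight]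
      push_cast
      ring
    · intro j
      obtain ⟨s, hs⟩ := hmem j
      rw [hs]
      fin_cases s
      exacts [⟨0, rfl⟩, ⟨2, rfl⟩, ⟨1, rfl⟩, ⟨3, rfl⟩]
    · intro M _ f
      rw [hsum, Fin.sum_univ_four]
      rfl
  · refine ⟨![u 0, u 2, u 3, u 1], ?_, ?_, ?_, ?_⟩
    · intro s
      fin_cases s <;> apply hupos
    · intro ℓ1 ℓ2 ℓ3 ℓ4
      simp only [Matrix.cons_val]
      push_cast
      rw [q0, q1, q2, q3, quarticWeight]
      push_cast
      ring
    · intro j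
      obtain ⟨s, hs⟩ := hmem j
      rw [hs]
      fin_cases s
      exacts [⟨0, rfl⟩, ⟨3, rfl⟩, ⟨1, rfl⟩, ⟨2, rfl⟩]
    · intro M _ f
      rw [hsum, Fin.sum_univ_four, add_right_comm (f (u 0) + f (u 2))]
      rfl

end QuarticWeight

section WeightCount

open Polynomial in
theorem card_filter_sum_eq_sum_piAntidiag {V : Type} [Fintype V] (f : V → ℕ) (w : Fin 4 → ℕ)
    (c : ℕ) (hf : ∀ {M : Type} [AddCommMonoid M] (φ : ℕ → M),
      ∑ β : V, φ (f β) = φ 0 + c • ∑ s, φ (w s)) (r W : ℕ) :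
    (Finset.univ.filter fun β : Fin r → V => ∑ j, f (β j) = W).card =
      ∑ h ∈ Finset.range (r + 1), ∑ k ∈ Finset.piAntidiag (Finset.univ : Finset (Fin 4)) h,
        if W = ∑ s, k s * w s then
          r.choose h * Nat.multinomial Finset.univ k * c ^ h else 0 := by
  classical
  have h1 : (∑ β : V, (X : ℕ[X]) ^ f β) ^ r = ∑ β : Fin r → V, X ^ ∑ j, f (β j) := by
    rw [Fintype.sum_pow]
    exact Finset.sum_congr rfl fun β _ => Finset.prod_pow_eq_pow_sum _ _ _
  have h2 : (∑ β : Fin r → V, (X : ℕ[X]) ^ ∑ j, f (β j)).coeff W =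
      (Finset.univ.filter fun β : Fin r → V => ∑ j, f (β j) = W).card := by
    rw [finsetSum_coeff, Finset.card_filter]
    exact Finset.sum_congr rfl fun β _ => by rw [coeff_X_pow]; simp only [eq_comm]
  rw [← h2, ← h1, hf (fun i => (X : ℕ[X]) ^ i), pow_zero, add_comm, add_pow, finsetSum_coeff]
  refine Finset.sum_congr rfl fun h _ => ?_
  rw [one_pow, mul_one, _root_.smul_pow, Finset.sum_pow_eq_sum_piAntidiag, Finset.smul_sum, Finset.sum_mul,
    finsetSum_coeff]
  refine Finset.sum_congr rfl fun k _ => ?_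
  have h3 : ∏ s, ((X : ℕ[X]) ^ w s) ^ k s = X ^ ∑ s, k s * w s := by
    rw [← Finset.prod_pow_eq_pow_sum]
    exact Finset.prod_congr rfl fun s _ => by rw [← pow_mul, mul_comm]
  rw [h3, smul_mul_assoc, coeff_smul, coeff_mul_natCast, coeff_natCast_mul, coeff_X_pow]
  split_ifs <;> simp
  ring

theorem sum_range_prod_eq_sum_piAntidiag (r : ℕ) (G : (Fin 4 → ℕ) → ℕ) :
    ∑ ℓ ∈ Finset.range (r + 1) ×ˢ Finset.range (r + 1) ×ˢ
        Finset.range (r + 1) ×ˢ Finset.range (r + 1),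
      (if ℓ.1 + ℓ.2.1 + ℓ.2.2.1 + ℓ.2.2.2 ≤ r then G ![ℓ.1, ℓ.2.1, ℓ.2.2.1, ℓ.2.2.2] else 0) =
    ∑ h ∈ Finset.range (r + 1), ∑ k ∈ Finset.piAntidiag (Finset.univ : Finset (Fin 4)) h, G k := by
  classical
  rw [← Finset.sum_filter, Finset.sum_sigma']
  refine Finset.sum_bij'
    (fun ℓ _ => ⟨ℓ.1 + ℓ.2.1 + ℓ.2.2.1 + ℓ.2.2.2, ![ℓ.1, ℓ.2.1, ℓ.2.2.1, ℓ.2.2.2]⟩)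
    (fun k _ => (k.2 0, k.2 1, k.2 2, k.2 3)) ?_ ?_ ?_ ?_ ?_
  · intro ℓ hℓ
    simp only [Finset.mem_filter, Finset.mem_sigma, Finset.mem_range, Finset.mem_piAntidiag] at hℓ ⊢
    refine ⟨by omega, ?_, by simp⟩
    simp [Fin.sum_univ_four]
  · rintro ⟨h, k⟩ hk
    simp only [Finset.mem_sigma, Finset.mem_range, Finset.mem_piAntidiag, Fin.sum_univ_four] at hk
    simp only [Finset.mem_filter, Finset.mem_product, Finset.mem_range]
    omega
  · intro ℓ _
    rfl
  · rintro ⟨h, k⟩ hk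
    simp only [Finset.mem_sigma, Finset.mem_range, Finset.mem_piAntidiag, Fin.sum_univ_four] at hk
    have : ![k 0, k 1, k 2, k 3] = k := by
      ext s
      fin_cases s <;> rfl
    simp only [this, hk.2.1]
  · intro ℓ _
    rfl

end WeightCount

section Descent

variable {F E : Type} [Field F] [Fintype F] [Field E] [Fintype E] [Algebra F E]

theorem exists_generator_algebraMap_eq_pow {r : ℕ} (hE : Fintype.card E = Fintype.card F ^ r)
    {ω : E} (hω : ∀ x : E, x ≠ 0 → ∃ j : ℕ, ω ^ j = x) :
    ∃ g : F, (∀ x : F, x ≠ 0 → ∃ j : ℕ, g ^ j = x) ∧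
      algebraMap F E g = ω ^ psi r (Fintype.card F) := by
  refine ⟨Algebra.norm F ω, fun x hx => ?_, ?_⟩
  · obtain ⟨y, rfl⟩ := FiniteField.norm_surjective F E x
    obtain ⟨j, rfl⟩ := hω y (by rintro rfl; exact hx (Algebra.norm_zero ..))
    exact ⟨j, (map_pow _ _ _).symm⟩
  · rw [FiniteField.algebraMap_norm_eq_pow, Nat.card_eq_fintype_card, Nat.card_eq_fintype_card, hE,
      ← Nat.geomSum_eq Fintype.one_lt_card, psi]

theorem eq_zero_of_trace_mul_pow_eq_zero {r : ℕ} (hr : r.Prime)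
    (hE : Fintype.card E = Fintype.card F ^ r) {ρ : E} {a : F} (ha : ρ ^ r = algebraMap F E a)
    (hρ : ρ ^ Fintype.card F ≠ ρ) {γ : E}
    (hγ : ∀ j : Fin r, Algebra.trace F E (γ * ρ ^ (j : ℕ)) = 0) : γ = 0 := by
  have hfr : Module.finrank F E = r := by
    have := Module.card_eq_pow_finrank (K := F) (V := E)
    rw [hE] at this
    exact (Nat.pow_right_injective Fintype.one_lt_card this).symm
  have _ := Subalgebra.isSimpleOrder_of_finrank_prime F E (hfr ▸ hr)
  have htop : Algebra.adjoin F {ρ} = ⊤ := by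
    refine (eq_bot_or_eq_top _).resolve_left fun h => hρ ?_
    obtain ⟨b, rfl⟩ := Algebra.mem_bot.mp (h ▸ Algebra.self_mem_adjoin_singleton F ρ)
    rw [← map_pow, FiniteField.pow_card]
  have hpow (n : ℕ) : Algebra.trace F E (γ * ρ ^ n) = 0 := by
    have : γ * ρ ^ n = a ^ (n / r) • (γ * ρ ^ (n % r)) := by
      conv_lhs => rw [← Nat.div_add_mod n r, pow_add, pow_mul, ha]
      rw [Algebra.smul_def, map_pow]
      ring
    rw [this, map_smul, hγ ⟨n % r, Nat.mod_lt _ hr.pos⟩, smul_zero]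
  have hker : (⊤ : Submodule F E) ≤
      LinearMap.ker (Algebra.trace F E ∘ₗ LinearMap.mulLeft F γ) := by
    rw [← Algebra.top_toSubmodule, ← htop, Algebra.adjoin_eq_span, Submodule.span_le]
    intro x hx
    obtain ⟨n, rfl⟩ := Submonoid.mem_closure_singleton.mp hx
    exact hpow n
  exact (traceForm_nondegenerate F E).1 γ fun z => hker (Submodule.mem_top (x := z))

theorem bijective_trace_mul_pow {r : ℕ} (hr : r.Prime)
    (hE : Fintype.card E = Fintype.card F ^ r) {ρ : E} {a : F} (ha : ρ ^ r = algebraMap F E a)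
    (hρ : ρ ^ Fintype.card F ≠ ρ) :
    Function.Bijective fun (γ : E) (j : Fin r) => Algebra.trace F E (γ * ρ ^ (j : ℕ)) := by
  rw [Fintype.bijective_iff_injective_and_card]
  refine ⟨fun γ γ' h => sub_eq_zero.mp
    (eq_zero_of_trace_mul_pow_eq_zero hr hE ha hρ fun j => ?_), by simp [hE]⟩
  rw [sub_mul, map_sub]
  exact sub_eq_zero.mpr (congrFun h j)

theorem wt_cycWord_eq_sum_periodWeight {p : ℕ} [Fact p.Prime] [Algebra (ZMod p) F]
    [Algebra (ZMod p) E] [IsScalarTower (ZMod p) F E] {ω : E} {g : F} {k r c : ℕ}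
    (hg : (ω ^ k) ^ r = algebraMap F E (g ^ 4)) (γ : E) :
    wt (cycWord p E ω k (c * r) γ) =
      ∑ j : Fin r, periodWeight p g c (Algebra.trace F E (γ * (ω ^ k) ^ (j : ℕ))) := by
  simp only [wt, periodWeight, Finset.card_filter]
  rw [← Equiv.sum_comp finProdFinEquiv, Fintype.sum_prod_type_right]
  refine Finset.sum_congr rfl fun j _ => ?_
  rw [Finset.sum_range]
  refine Finset.sum_congr rfl fun i _ => ?_
  have h : γ * ω ^ (k * ((j : ℕ) + r * i)) = (g ^ (4 * (i : ℕ))) • (γ * (ω ^ k) ^ (j : ℕ)) := by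
    rw [pow_mul, pow_add, pow_mul _ r, hg, ← map_pow, ← pow_mul g, Algebra.smul_def,
      ← mul_assoc, mul_comm]
  have h' : cycWord p E ω k (c * r) γ (finProdFinEquiv (i, j)) = Algebra.trace (ZMod p) F
      (Algebra.trace F E (γ * (ω ^ k) ^ (j : ℕ)) * g ^ (4 * (i : ℕ))) := by
    rw [cycWord, finProdFinEquiv_apply_val, h, ← Algebra.trace_trace (S := F), map_smul,
      smul_eq_mul, mul_comm]
  rw [h']

theorem cycWord_sub (p : ℕ) [Algebra (ZMod p) E] (ω : E) (k n : ℕ) (γ γ' : E) :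
    cycWord p E ω k n (γ - γ') = cycWord p E ω k n γ - cycWord p E ω k n γ' := by
  ext i
  simp [cycWord, sub_mul]

theorem freq_eq_card_filter_sum_periodWeight {p : ℕ} [Fact p.Prime] [Algebra (ZMod p) F]
    [Algebra (ZMod p) E] [IsScalarTower (ZMod p) F E] {ω : E} {g : F} {k r c : ℕ}
    (hr : r.Prime) (hE : Fintype.card E = Fintype.card F ^ r)
    (hg : (ω ^ k) ^ r = algebraMap F E (g ^ 4)) (hρ : (ω ^ k) ^ Fintype.card F ≠ ω ^ k)
    (hpos : ∀ β : F, β ≠ 0 → 0 < periodWeight p g c β) (W : ℕ) :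
    freq p E ω k (c * r) W =
      (Finset.univ.filter fun β : Fin r → F => ∑ j, periodWeight p g c (β j) = W).card := by
  classical
  have hinj : Function.Injective (cycWord p E ω k (c * r)) := by
    intro γ γ' h
    refine sub_eq_zero.mp (eq_zero_of_trace_mul_pow_eq_zero hr hE hg hρ fun j => ?_)
    have h0 : wt (cycWord p E ω k (c * r) (γ - γ')) = 0 := by
      rw [cycWord_sub, h, sub_self]
      simp [wt]
    rw [wt_cycWord_eq_sum_periodWeight hg, Finset.sum_eq_zero_iff] at h0
    by_contra hne
    exact (hpos _ hne).ne' (h0 j (Finset.mem_univ j))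
  rw [freq, cycCode, Finset.filter_image, Finset.card_image_of_injective _ hinj]
  refine Finset.card_bijective _ (bijective_trace_mul_pow hr hE hg hρ) fun γ => ?_
  simp only [Finset.mem_filter, Finset.mem_univ, true_and, wt_cycWord_eq_sum_periodWeight hg]

end Descent

theorem stmt10 (p r t m c k n : ℕ) (hp : p.Prime) (hr : r.Prime) (hrodd : Odd r)
    (hpr : p ≠ r) (hp4 : Nat.ModEq 4 p 1) (ht : 0 < t) (hm : m = 4 * t)
    (hc : 4 * c = p ^ m - 1) (hk : r * k = 4 * psi r (p ^ m))
    (hq1 : Nat.ModEq r (p ^ m) 1) (h4r : Nat.Coprime 4 r)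
    (hcprim : IsPrimitiveDivisor c p m)
    (A B : ℤ) (hAB : ((p : ℤ) ^ (2 * t)) = A ^ 2 + 4 * B ^ 2)
    (hA1 : Int.ModEq 4 A 1) (hAp : Int.gcd A (p : ℤ) = 1)
    (E : Type) [Field E] [Fintype E] [Algebra (ZMod p) E]
    (hE : Fintype.card E = p ^ (m * r))
    (ω : E) (hω : ∀ x : E, x ≠ 0 → ∃ j : ℕ, ω ^ j = x)
    (hn : n * k = p ^ (m * r) - 1) :
    (∀ x ∈ cycCode p E ω k n, ∃ ℓ1 ℓ2 ℓ3 ℓ4 : ℕ, ℓ1 + ℓ2 + ℓ3 + ℓ4 ≤ r ∧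
        (wt x : ℚ) = quarticWeight p t m A B ℓ1 ℓ2 ℓ3 ℓ4) ∧
    (∀ ℓ1 ℓ2 ℓ3 ℓ4 : ℕ, ℓ1 + ℓ2 + ℓ3 + ℓ4 ≤ r →
        ∃ x ∈ cycCode p E ω k n, (wt x : ℚ) = quarticWeight p t m A B ℓ1 ℓ2 ℓ3 ℓ4) ∧
    (∀ W : ℕ, freq p E ω k n W =
        ∑ ℓ ∈ Finset.range (r + 1) ×ˢ Finset.range (r + 1) ×ˢ
              Finset.range (r + 1) ×ˢ Finset.range (r + 1),
          if ℓ.1 + ℓ.2.1 + ℓ.2.2.1 + ℓ.2.2.2 ≤ r ∧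
              (W : ℚ) = quarticWeight p t m A B ℓ.1 ℓ.2.1 ℓ.2.2.1 ℓ.2.2.2
          then Nat.choose r (ℓ.1 + ℓ.2.1 + ℓ.2.2.1 + ℓ.2.2.2) *
               Nat.multinomial Finset.univ ![ℓ.1, ℓ.2.1, ℓ.2.2.1, ℓ.2.2.2] *
               c ^ (ℓ.1 + ℓ.2.1 + ℓ.2.2.1 + ℓ.2.2.2)
          else 0) := by
  classical
  subst hm
  have _ : Fact p.Prime := ⟨hp⟩
  have hm0 : 4 * t ≠ 0 := by omega
  have hr2 : 2 ≤ r := hr.two_le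
  have hq2 : 2 ≤ p ^ (4 * t) := hp.two_le.trans (Nat.le_self_pow hm0 p)
  have hpsi : psi r (p ^ (4 * t)) * (p ^ (4 * t) - 1) = p ^ (4 * t * r) - 1 := by
    rw [pow_mul p (4 * t), psi]
    exact geom_sum_mul_of_one_le (Nat.one_le_of_lt hq2) r
  have hcardpos : 2 < p ^ (4 * t * r) := by
    rw [pow_mul]
    calc 2 < 2 ^ 2 := by norm_num
      _ ≤ 2 ^ r := Nat.pow_le_pow_right (by norm_num) hr2
      _ ≤ _ := Nat.pow_le_pow_left hq2 r
  have hkpos : 0 < k := by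
    refine Nat.pos_of_ne_zero fun h => ?_
    rw [h, mul_zero] at hn
    omega
  have hcpos : 0 < c := by omega
  obtain rfl : n = c * r := by
    refine Nat.eq_of_mul_eq_mul_right hkpos ?_
    rw [hn, ← hpsi, ← hc, mul_assoc, hk]
    ring
  have hω0 : ω ≠ 0 := by
    rintro rfl
    have h : (Finset.univ : Finset E) ⊆ {0, 1} := fun x _ => by
      by_cases hx : x = 0
      · simp [hx]
      · obtain ⟨j, rfl⟩ := hω x hx
        rcases eq_or_ne j 0 with rfl | hj
        · simp
        · simp [hj]
    have := (Finset.card_le_card h).trans Finset.card_le_two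
    rw [Finset.card_univ, hE] at this
    omega
  let _ := Fintype.ofFinite (GaloisField p (4 * t))
  have hF : Fintype.card (GaloisField p (4 * t)) = p ^ (4 * t) := by
    rw [← Nat.card_eq_fintype_card, GaloisField.card p _ hm0]
  have hfE : Module.finrank (ZMod p) E = 4 * t * r := by
    have := Module.card_eq_pow_finrank (K := ZMod p) (V := E)
    rw [hE, ZMod.card] at this
    exact (Nat.pow_right_injective hp.two_le this).symm
  obtain ⟨ι⟩ := FiniteField.nonempty_algHom_of_finrank_dvd (F := ZMod p)
    (K := GaloisField p (4 * t)) (L := E)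
    (by rw [GaloisField.finrank p hm0, hfE]; exact ⟨r, rfl⟩)
  let _ : Algebra (GaloisField p (4 * t)) E := ι.toRingHom.toAlgebra
  have _ : IsScalarTower (ZMod p) (GaloisField p (4 * t)) E :=
    IsScalarTower.of_algebraMap_eq fun x => (ι.commutes x).symm
  have hEF : Fintype.card E = Fintype.card (GaloisField p (4 * t)) ^ r := by rw [hE, hF, pow_mul]
  obtain ⟨g, hg, hgω⟩ := exists_generator_algebraMap_eq_pow hEF hω
  have hg0 : g ≠ 0 := by
    rintro rfl
    rw [map_zero] at hgω
    exact pow_ne_zero _ hω0 hgω.symm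
  have hρr : (ω ^ k) ^ r = algebraMap (GaloisField p (4 * t)) E (g ^ 4) := by
    rw [map_pow, hgω, ← pow_mul, ← pow_mul, mul_comm k, hk, hF, mul_comm 4]
  have hρ : (ω ^ k) ^ Fintype.card (GaloisField p (4 * t)) ≠ ω ^ k := by
    intro h
    have h1 : ω ^ (k * (p ^ (4 * t) - 1)) = 1 := by
      refine mul_right_cancel₀ (pow_ne_zero k hω0) ?_
      rw [one_mul, ← pow_add, ← Nat.mul_succ, Nat.succ_eq_add_one, Nat.sub_add_cancel (by omega),
        pow_mul, ← hF, h]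
    obtain ⟨d, hd⟩ := orderOf_dvd_of_pow_eq_one h1
    rw [orderOf_eq_card_sub_one hω0 hω, hE] at hd
    have h2 : (p ^ (4 * t * r) - 1) * (r * d) = (p ^ (4 * t * r) - 1) * 4 := by
      calc (p ^ (4 * t * r) - 1) * (r * d) = r * k * (p ^ (4 * t) - 1) := by
            rw [mul_assoc r, hd]; ring
        _ = _ := by rw [hk, mul_assoc, hpsi, mul_comm]
    have h3 : r ∣ 4 := ⟨d, (Nat.eq_of_mul_eq_mul_left (by omega) h2).symm⟩
    exact hr.one_lt.ne' (Nat.Coprime.eq_one_of_dvd h4r.symm h3)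
  obtain ⟨w, hw0, hwq, hwp, hwsum⟩ := exists_quartic_weights (p := p) (t := t) hp4 ht hF hg0 hg
    (c := c) (by rw [hF, hc]) hAB hA1 hAp
  have hpos (β : GaloisField p (4 * t)) (hβ : β ≠ 0) : 0 < periodWeight p g c β := by
    obtain ⟨j, rfl⟩ := hg β hβ
    obtain ⟨s, hs⟩ := hwp j
    exact hs ▸ hw0 s
  have hfreq (W : ℕ) : freq p E ω k (c * r) W = _ :=
    (freq_eq_card_filter_sum_periodWeight hr hEF hρr hρ hpos W).trans <|
      (card_filter_sum_eq_sum_piAntidiag _ w c hwsum r W)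
  have key (W : ℕ) : freq p E ω k (c * r) W =
        ∑ ℓ ∈ Finset.range (r + 1) ×ˢ Finset.range (r + 1) ×ˢ
              Finset.range (r + 1) ×ˢ Finset.range (r + 1),
          if ℓ.1 + ℓ.2.1 + ℓ.2.2.1 + ℓ.2.2.2 ≤ r ∧
              (W : ℚ) = quarticWeight p t (4 * t) A B ℓ.1 ℓ.2.1 ℓ.2.2.1 ℓ.2.2.2
          then Nat.choose r (ℓ.1 + ℓ.2.1 + ℓ.2.2.1 + ℓ.2.2.2) *
               Nat.multinomial Finset.univ ![ℓ.1, ℓ.2.1, ℓ.2.2.1, ℓ.2.2.2] *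
               c ^ (ℓ.1 + ℓ.2.1 + ℓ.2.2.1 + ℓ.2.2.2)
          else 0 := by
    let G (k : Fin 4 → ℕ) : ℕ := if W = ∑ s, k s * w s then
      r.choose (∑ s, k s) * Nat.multinomial Finset.univ k * c ^ (∑ s, k s) else 0
    have hG := sum_range_prod_eq_sum_piAntidiag r G
    rw [hfreq]
    refine Eq.trans (Finset.sum_congr rfl fun h _ => Finset.sum_congr rfl fun k hk => ?_)
      (hG.symm.trans (Finset.sum_congr rfl fun ℓ _ => ?_))
    · simp only [G, (Finset.mem_piAntidiag.mp hk).1]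
    · simp only [G, hwq, Nat.cast_inj, ite_and, Fin.sum_univ_four, Matrix.cons_val]
      congr!
  refine ⟨fun x hx => ?_, fun ℓ1 ℓ2 ℓ3 ℓ4 hℓ => ?_, key⟩
  · have h : freq p E ω k (c * r) (wt x) ≠ 0 :=
      Finset.card_ne_zero_of_mem (Finset.mem_filter.mpr ⟨hx, rfl⟩)
    rw [key] at h
    obtain ⟨ℓ, -, hℓ⟩ := Finset.exists_ne_zero_of_sum_ne_zero h
    obtain ⟨h1, h2⟩ := (ite_ne_right_iff.mp hℓ).1
    exact ⟨_, _, _, _, h1, h2⟩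
  · have h : 0 < freq p E ω k (c * r) (ℓ1 * w 0 + ℓ2 * w 1 + ℓ3 * w 2 + ℓ4 * w 3) := by
      rw [key]
      refine Finset.sum_pos' (fun _ _ => Nat.zero_le _) ⟨(ℓ1, ℓ2, ℓ3, ℓ4), ?_, ?_⟩
      · simp only [Finset.mem_product, Finset.mem_range]
        omega
      · rw [if_pos ⟨hℓ, (hwq ℓ1 ℓ2 ℓ3 ℓ4).symm⟩]
        have := Nat.choose_pos hℓ
        have := Nat.multinomial_pos Finset.univ ![ℓ1, ℓ2, ℓ3, ℓ4]
        positivity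
    obtain ⟨x, hx⟩ := Finset.card_pos.mp h
    obtain ⟨hx1, hx2⟩ := Finset.mem_filter.mp hx
    exact ⟨x, hx1, by rw [hx2, hwq]⟩
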